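/- arXiv:1709.07649 — 2 statements merged into one kernel-verified Lean document; each statement's English description precedes it below -/
import Mathlib

section
/- Let n ≥ 2 and let Γₙ⁻ be the subgroup of Aff(ℝⁿ) generated by the translations ℤⁿ × {Iₙ} together with (0, −Iₙ). Then Spec_R(Γₙ⁻) = 2ℕ ∪ {3, ∞} (the positive even integers together with 3 and ∞) if n = 2, and Spec_R(Γₙ⁻) = (ℕ \ {1}) ∪ {∞} (all integers ≥ 2 together with ∞) if n ≥ 3. -/
open Matrix

noncomputable section

@[ext]
structure Aff (n : ℕ) where
  tr : Fin n → ℝ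
  lin : GL (Fin n) ℝ

namespace Aff

variable {n : ℕ}

instance : Mul (Aff n) :=
  ⟨fun a b => ⟨a.tr + (a.lin : Matrix (Fin n) (Fin n) ℝ) *ᵥ b.tr, a.lin * b.lin⟩⟩

instance : One (Aff n) := ⟨⟨0, 1⟩⟩

instance : Inv (Aff n) :=
  ⟨fun a => ⟨((a.lin⁻¹ : GL (Fin n) ℝ) : Matrix (Fin n) (Fin n) ℝ) *ᵥ (-a.tr), a.lin⁻¹⟩⟩

theorem mul_def (a b : Aff n) :
    a * b = ⟨a.tr + (a.lin : Matrix (Fin n) (Fin n) ℝ) *ᵥ b.tr, a.lin * b.lin⟩ := rfl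

theorem one_def : (1 : Aff n) = ⟨0, 1⟩ := rfl

theorem inv_def (a : Aff n) :
    a⁻¹ = ⟨((a.lin⁻¹ : GL (Fin n) ℝ) : Matrix (Fin n) (Fin n) ℝ) *ᵥ (-a.tr), a.lin⁻¹⟩ := rfl

instance : Group (Aff n) where
  mul_assoc a b c := by
    ext i
    · simp [mul_def, Matrix.mulVec_add, Matrix.mulVec_mulVec, add_assoc, Units.val_mul]
    · simp [mul_def, mul_assoc]
  one_mul a := by
    ext i
    · simp [mul_def, one_def]
    · simp [mul_def, one_def]
  mul_one a := by
    ext i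
    · simp [mul_def, one_def]
    · simp [mul_def, one_def]
  inv_mul_cancel a := by
    ext i
    · simp [mul_def, inv_def, one_def, Matrix.mulVec_neg]
    · simp [mul_def, inv_def, one_def]

end Aff

/-- The translation subgroup of `Γ` is exactly `ℤⁿ × {Iₙ}`. -/
def HasIntTranslations {n : ℕ} (Γ : Subgroup (Aff n)) : Prop :=
  ∀ v : Fin n → ℝ, (Aff.mk v 1 ∈ Γ ↔ ∃ z : Fin n → ℤ, v = fun i => (z i : ℝ))

/-- The holonomy group of `Γ`, as the set of linear parts of elements of `Γ`. -/
def holonomy {n : ℕ} (Γ : Subgroup (Aff n)) : Set (GL (Fin n) ℝ) :=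
  {D : GL (Fin n) ℝ | ∃ a : Fin n → ℝ, Aff.mk a D ∈ Γ}

/-- `D ∈ GLₙ(ℤ)`: both `D` and `D⁻¹` have integer entries. -/
def IsIntegralGL {n : ℕ} (D : GL (Fin n) ℝ) : Prop :=
  (∀ i j, ∃ z : ℤ, (D : Matrix (Fin n) (Fin n) ℝ) i j = (z : ℝ)) ∧
  (∀ i j, ∃ z : ℤ, ((D⁻¹ : GL (Fin n) ℝ) : Matrix (Fin n) (Fin n) ℝ) i j = (z : ℝ))

/-- `Γ ≤ Aff(ℝⁿ)` is an `n`-dimensional crystallographic group. -/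
def IsCrystallographic {n : ℕ} (Γ : Subgroup (Aff n)) : Prop :=
  HasIntTranslations Γ ∧ (holonomy Γ).Finite ∧ ∀ D ∈ holonomy Γ, IsIntegralGL D

/-- Conjugation by `g` maps `Γ` bijectively onto itself, i.e. `ξ_g` is an automorphism of `Γ`. -/
def XiIsAut {n : ℕ} (g : Aff n) (Γ : Subgroup (Aff n)) : Prop :=
  ∀ γ : Aff n, γ ∈ Γ ↔ g * γ * g⁻¹ ∈ Γ

def twistedConj {G : Type*} [Group G] (φ : G →* G) (g g' : G) : Prop :=
  ∃ h : G, g = h * g' * (φ h)⁻¹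

noncomputable def reidemeisterNumber {G : Type*} [Group G] (φ : G →* G) : ℕ∞ :=
  ENat.card (Quot (twistedConj φ))

noncomputable def reidemeisterSpectrum (G : Type*) [Group G] : Set ℕ∞ :=
  {r : ℕ∞ | ∃ φ : G ≃* G, reidemeisterNumber (φ : G →* G) = r}

/-- The automorphism `ξ_{(d,D)}` of `Γ`, given by conjugation by `g = (d,D)`. -/
def xi {n : ℕ} (g : Aff n) (Γ : Subgroup (Aff n)) (h : XiIsAut g Γ) : Γ →* Γ where
  toFun x := ⟨g * (x : Aff n) * g⁻¹, (h x).mp x.2⟩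
  map_one' := by
    apply Subtype.ext
    show g * ((1 : Γ) : Aff n) * g⁻¹ = ((1 : Γ) : Aff n)
    simp
  map_mul' x y := by
    apply Subtype.ext
    show g * ((x * y : Γ) : Aff n) * g⁻¹ =
      (g * (x : Aff n) * g⁻¹) * (g * (y : Aff n) * g⁻¹)
    simp only [Subgroup.coe_mul]
    group

/-- `|x|_∞` for an integer `x`. -/
def intAbsInfty (x : ℤ) : ℕ∞ := if x = 0 then ⊤ else (x.natAbs : ℕ∞)

/-- `O(B,b)`: the number of solutions over `ℤ/2ℤ` of `B̄ x = b̄`. -/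
noncomputable def Ocount {n : ℕ} (B : Matrix (Fin n) (Fin n) ℤ) (b : Fin n → ℤ) : ℕ :=
  Nat.card {x : Fin n → ZMod 2 // (B.map (Int.cast : ℤ → ZMod 2)) *ᵥ x = fun i => ((b i : ZMod 2))}

/-- The crystallographic group `Γₙ⁻ = ⟨ℤⁿ, (0, -Iₙ)⟩ ≤ Aff(ℝⁿ)`. -/
def GammaMinus (n : ℕ) : Subgroup (Aff n) :=
  Subgroup.closure
    ({g : Aff n | ∃ z : Fin n → ℤ, g = Aff.mk (fun i => (z i : ℝ)) 1} ∪ {Aff.mk 0 (-1)})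

set_option linter.unusedSimpArgs false

/-- Orbit space of the involution `p ↦ c - p` on the quotient of `A` by `N`. -/
def invRel {X : Type*} [AddCommGroup X] (c : X) (p q : X) : Prop := p = q ∨ p + q = c

theorem invRel_equivalence {X : Type*} [AddCommGroup X] (c : X) : Equivalence (invRel c) where
  refl x := Or.inl rfl
  symm := by
    rintro x y (h | h)
    · exact Or.inl h.symm
    · exact Or.inr (by rw [add_comm]; exact h)
  trans := by
    rintro x y z (rfl | h) (rfl | h')
    · exact Or.inl rfl
    · exact Or.inr h'
    · exact Or.inr h
    · left
      rw [add_comm] at h'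
      exact add_right_cancel (h.trans h'.symm)

theorem mk_invRel_iff {X : Type*} [AddCommGroup X] (c : X) (p q : X) :
    Quot.mk (invRel c) p = Quot.mk (invRel c) q ↔ invRel c p q :=
  (invRel_equivalence c).quot_mk_eq_iff p q

theorem infinite_invRel {X : Type*} [AddCommGroup X] (c : X) [Finite (Quot (invRel c))] :
    Finite X := by
  have := Set.Finite.of_finite_fibers (Quot.mk (invRel c)) (s := Set.univ) (Set.toFinite _) (by
    rintro q -
    obtain ⟨x, rfl⟩ := Quot.exists_rep q
    refine (Set.toFinite {x, c - x}).subset ?_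
    rintro y ⟨-, hy⟩
    rcases (mk_invRel_iff c y x).1 hy with h | h
    · simp [h]
    · right
      simp [← h])
  exact Set.finite_univ_iff.1 this

theorem two_mul_card_invRel {X : Type*} [AddCommGroup X] [Finite X] (c : X) :
    2 * Nat.card (Quot (invRel c)) = Nat.card X + Nat.card {z : X // z + z = c} := by
  classical
  have := Fintype.ofFinite X
  have : Fintype (Quot (invRel c)) := Fintype.ofFinite _
  have h1 : Nat.card X = ∑ q : Quot (invRel c),
      (Finset.univ.filter (fun x : X => Quot.mk (invRel c) x = q)).card := by
    rw [Nat.card_eq_fintype_card, ← Finset.card_univ]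
    exact Finset.card_eq_sum_card_fiberwise (fun _ _ => Finset.mem_coe.2 (Finset.mem_univ _))
  have h2 : Nat.card {z : X // z + z = c} = ∑ q : Quot (invRel c),
      ((Finset.univ.filter (fun z : X => z + z = c)).filter
        (fun x : X => Quot.mk (invRel c) x = q)).card := by
    rw [Nat.card_eq_fintype_card, Fintype.card_subtype]
    exact Finset.card_eq_sum_card_fiberwise (fun _ _ => Finset.mem_coe.2 (Finset.mem_univ _))
  rw [h1, h2, ← Finset.sum_add_distrib, Finset.sum_congr rfl (g := fun _ => 2)]
  · simp [mul_comm]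
  · intro q _
    obtain ⟨x, rfl⟩ := Quot.exists_rep q
    have e1 : Finset.univ.filter (fun y : X => Quot.mk (invRel c) y = Quot.mk (invRel c) x)
        = {x, c - x} := by
      ext y
      simp only [Finset.mem_filter, Finset.mem_univ, true_and, Finset.mem_insert,
        Finset.mem_singleton, mk_invRel_iff, invRel, eq_sub_iff_add_eq]
    rw [Finset.filter_comm, e1]
    by_cases hx : x + x = c
    · have : c - x = x := by rw [← hx]; simp
      simp [this, hx, Finset.filter_singleton]
    · have h' : x ≠ c - x := fun h => hx (eq_sub_iff_add_eq.1 h)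
      have h3 : ¬ (c - x + (c - x) = c) := by
        intro h
        apply hx
        have : c - (x + x) = 0 := by
          have : c - x + (c - x) - c = 0 := by rw [h, sub_self]
          rw [← this]; abel
        exact (sub_eq_zero.1 this).symm
      rw [Finset.card_pair h']
      simp [Finset.filter_insert, Finset.filter_singleton, hx, h3]

/-- The doubling map. -/
def dbl (X : Type*) [AddCommGroup X] : X →+ X where
  toFun x := x + x
  map_zero' := by simp
  map_add' x y := by abel

theorem card_halves {X : Type*} [AddCommGroup X] [Finite X] (c : X) :
    Nat.card {z : X // z + z = c} =
      open Classical in if c ∈ (dbl X).range then (dbl X).range.index else 0 := by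
  classical
  split_ifs with h
  · obtain ⟨w, hw⟩ := h
    have hw : w + w = c := hw
    rw [AddSubgroup.index_range]
    refine Nat.card_congr ⟨fun z => ⟨z.1 - w, ?_⟩, fun z => ⟨z.1 + w, ?_⟩, ?_, ?_⟩
    · have := z.2
      show z.1 - w + (z.1 - w) = 0
      have e : z.1 - w + (z.1 - w) = (z.1 + z.1) - (w + w) := by abel
      rw [e, this, hw, sub_self]
    · have : z.1 + z.1 = 0 := z.2
      have e : z.1 + w + (z.1 + w) = (z.1 + z.1) + (w + w) := by abel
      rw [e, this, hw, zero_add]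
    · intro z; simp
    · intro z; simp
  · have : IsEmpty {z : X // z + z = c} := ⟨fun z => h ⟨z.1, z.2⟩⟩
    simp

theorem card_halves_odd {X : Type*} [AddCommGroup X] [Finite X] (c : X)
    (h : Odd (Nat.card X)) : Nat.card {z : X // z + z = c} = 1 := by
  have hinj : Function.Injective (dbl X) := by
    rw [injective_iff_map_eq_zero]
    intro a ha
    have ha : a + a = 0 := ha
    have h1 : addOrderOf a ∣ 2 := addOrderOf_dvd_of_nsmul_eq_zero (by rw [two_nsmul, ha])
    have h2 : addOrderOf a ∣ Nat.card X := addOrderOf_dvd_natCard a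
    have : addOrderOf a ∣ 1 := by
      rw [← (Nat.coprime_two_left.2 h).gcd_eq_one]
      exact Nat.dvd_gcd h1 h2
    exact AddMonoid.addOrderOf_eq_one_iff.1 (Nat.dvd_one.1 this)
  have hsurj := Finite.surjective_of_injective hinj
  obtain ⟨w, hw⟩ := hsurj c
  have hw : w + w = c := hw
  have : Unique {z : X // z + z = c} :=
    ⟨⟨⟨w, hw⟩⟩, fun z => Subtype.ext (hinj (show z.1 + z.1 = w + w by rw [z.2, hw]))⟩
  exact Nat.card_unique

/-- The subgroup of elements `x - f x`. -/
def coN {A : Type*} [AddCommGroup A] (f : A →+ A) : AddSubgroup A :=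
  (AddMonoidHom.id A - f).range

theorem mem_coN {A : Type*} [AddCommGroup A] (f : A →+ A) (a : A) :
    a ∈ coN f ↔ ∃ x, x - f x = a := Iff.rfl

theorem comap_dbl {A : Type*} [AddCommGroup A] (f : A →+ A) (a : A) :
    (a : A ⧸ coN f) ∈ (dbl (A ⧸ coN f)).range ↔ ∃ x y, a = x + x + (y - f y) := by
  constructor
  · rintro ⟨z, hz⟩
    obtain ⟨x, rfl⟩ := QuotientAddGroup.mk_surjective z
    have hz : ((x + x : A) : A ⧸ coN f) = a := hz
    rw [QuotientAddGroup.eq] at hz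
    obtain ⟨y, hy⟩ := hz
    exact ⟨x, y, by rw [show y - f y = _ from hy]; abel⟩
  · rintro ⟨x, y, rfl⟩
    refine ⟨(x : A ⧸ coN f), ?_⟩
    show ((x + x : A) : A ⧸ coN f) = _
    rw [QuotientAddGroup.eq]
    exact ⟨y, show y - f y = _ by abel⟩

theorem card_halves_eq {A : Type*} [AddCommGroup A] (f : A →+ A) (b : A)
    [Finite (A ⧸ coN f)] [Finite (A ⧸ coN (-f))] :
    Nat.card {z : A ⧸ coN f // z + z = ((-b : A) : A ⧸ coN f)} =
      Nat.card {z : A ⧸ coN (-f) // z + z = (b : A ⧸ coN (-f))} := by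
  have key : (dbl (A ⧸ coN f)).range.comap (QuotientAddGroup.mk' (coN f)) =
      (dbl (A ⧸ coN (-f))).range.comap (QuotientAddGroup.mk' (coN (-f))) := by
    ext a
    show (a : A ⧸ coN f) ∈ (dbl (A ⧸ coN f)).range ↔ (a : A ⧸ coN (-f)) ∈ (dbl (A ⧸ coN (-f))).range
    rw [comap_dbl, comap_dbl]
    constructor
    · rintro ⟨x, y, rfl⟩
      exact ⟨x - f y, y, by simp; abel⟩
    · rintro ⟨x, y, rfl⟩
      exact ⟨x + f y, y, by simp; abel⟩
  have hi : (dbl (A ⧸ coN f)).range.index = (dbl (A ⧸ coN (-f))).range.index := by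
    rw [← AddSubgroup.index_comap_of_surjective _ (QuotientAddGroup.mk'_surjective (coN f)), key,
      AddSubgroup.index_comap_of_surjective _ (QuotientAddGroup.mk'_surjective _)]
  have hm : (((-b : A) : A ⧸ coN f) ∈ (dbl (A ⧸ coN f)).range) ↔
      ((b : A ⧸ coN (-f)) ∈ (dbl (A ⧸ coN (-f))).range) := by
    have := SetLike.ext_iff.1 key b
    refine Iff.trans ?_ this
    rw [QuotientAddGroup.mk_neg, neg_mem_iff]
    rfl
  rw [card_halves, card_halves, hi]
  by_cases h : ((b : A ⧸ coN (-f)) ∈ (dbl (A ⧸ coN (-f))).range)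
  · rw [if_pos h, if_pos (hm.2 h)]
  · rw [if_neg h, if_neg (fun h2 => h (hm.1 h2))]

/-- Reidemeister classes for a generalized dihedral group. -/
theorem reid_equiv {G A : Type*} [Group G] [AddCommGroup A] (T : A → G) (s : G)
    (hadd : ∀ a b, T (a + b) = T a * T b) (hinj : Function.Injective T)
    (hs : s * s = 1) (hsT : ∀ a, s * T a = T (-a) * s)
    (hall : ∀ g, (∃ a, g = T a) ∨ ∃ a, g = T a * s) (hne : ∀ a b, T a ≠ T b * s)
    (φ : G →* G) (f : A →+ A) (b : A) (hφ : ∀ a, φ (T a) = T (f a)) (hφs : φ s = T b * s) :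
    reidemeisterNumber φ = ENat.card (Quot (invRel ((-b : A) : A ⧸ coN f))) +
      ENat.card (Quot (invRel (b : A ⧸ coN (-f)))) := by
  have h0 : T 0 = 1 := by
    have := hadd 0 0
    simpa using this
  have hneg : ∀ a, (T a)⁻¹ = T (-a) := fun a => by
    rw [inv_eq_iff_mul_eq_one, ← hadd]; simp [h0]
  have hsi : s⁻¹ = s := inv_eq_of_mul_eq_one_left hs
  have hsT' : ∀ a g, s * (T a * g) = T (-a) * (s * g) := fun a g => by
    rw [← mul_assoc, hsT, mul_assoc]
  have hss : ∀ g, s * (s * g) = g := fun g => by rw [← mul_assoc, hs, one_mul]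
  have hadd' : ∀ a b g, T a * (T b * g) = T (a + b) * g := fun a b g => by
    rw [hadd, mul_assoc]
  have hsinj : ∀ a b, T a * s = T b * s ↔ a = b := fun a b =>
    ⟨fun h => hinj (mul_right_cancel h), fun h => by rw [h]⟩
  have r11 : ∀ z w, twistedConj φ (T z) (T w) ↔
      invRel ((-b : A) : A ⧸ coN f) (z : A ⧸ coN f) (w : A ⧸ coN f) := by
    intro z w
    have e1 : ((z : A ⧸ coN f) = w) ↔ ∃ x, z = x + w - f x := by
      rw [eq_comm, QuotientAddGroup.eq, mem_coN]
      exact exists_congr fun x => ⟨fun h => by rw [add_sub_right_comm, h]; abel,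
        fun h => by rw [h]; abel⟩
    have e2 : ((z : A ⧸ coN f) + w = ((-b : A) : A ⧸ coN f)) ↔ ∃ x, z = x - w - f x - b := by
      rw [← QuotientAddGroup.mk_add, eq_comm, QuotientAddGroup.eq, mem_coN]
      exact exists_congr fun x => ⟨fun h => by
        rw [show x - w - f x - b = (x - f x) - w - b by abel, h]; abel,
        fun h => by rw [h]; abel⟩
    rw [invRel, e1, e2]
    constructor
    · rintro ⟨h, hh⟩
      rcases hall h with ⟨x, rfl⟩ | ⟨x, rfl⟩
      · left
        refine ⟨x, ?_⟩
        rw [hφ, hneg, ← hadd, ← hadd] at hh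
        rw [hinj hh]; abel
      · right
        refine ⟨x, ?_⟩
        rw [map_mul, hφ, hφs] at hh
        simp only [_root_.mul_inv_rev, one_mul, mul_one, hneg, hsi, mul_assoc, hsT, hsT', hss, hadd', ← hadd, hs] at hh
        rw [hinj hh]; abel
    · rintro (⟨x, rfl⟩ | ⟨x, rfl⟩)
      · refine ⟨T x, ?_⟩
        rw [hφ, hneg, ← hadd, ← hadd]; congr 1; abel
      · refine ⟨T x * s, ?_⟩
        rw [map_mul, hφ, hφs]
        simp only [_root_.mul_inv_rev, one_mul, mul_one, hneg, hsi, mul_assoc, hsT, hsT', hss, hadd', ← hadd, hs]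
        congr 1; abel
  have r22 : ∀ z w, twistedConj φ (T z * s) (T w * s) ↔
      invRel (b : A ⧸ coN (-f)) (z : A ⧸ coN (-f)) (w : A ⧸ coN (-f)) := by
    intro z w
    have e1 : ((z : A ⧸ coN (-f)) = w) ↔ ∃ x, z = x + w + f x := by
      rw [eq_comm, QuotientAddGroup.eq, mem_coN]
      exact exists_congr fun x => ⟨fun h => by
        rw [show x + w + f x = (x - (-f) x) + w by simp; abel, h]; abel,
        fun h => by rw [h]; simp; abel⟩
    have e2 : ((z : A ⧸ coN (-f)) + w = (b : A ⧸ coN (-f))) ↔ ∃ x, z = x - w + f x + b := by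
      rw [← QuotientAddGroup.mk_add, eq_comm, QuotientAddGroup.eq, mem_coN]
      exact exists_congr fun x => ⟨fun h => by
        rw [show x - w + f x + b = (x - (-f) x) - w + b by simp; abel, h]; abel,
        fun h => by rw [h]; simp; abel⟩
    rw [invRel, e1, e2]
    constructor
    · rintro ⟨h, hh⟩
      rcases hall h with ⟨x, rfl⟩ | ⟨x, rfl⟩
      · left
        refine ⟨x, ?_⟩
        rw [hφ] at hh
        simp only [_root_.mul_inv_rev, one_mul, mul_one, hneg, hsi, mul_assoc, hsT, hsT', hss, hadd', ← hadd, hs, hsinj] at hh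
        rw [hh]; abel
      · right
        refine ⟨x, ?_⟩
        rw [map_mul, hφ, hφs] at hh
        simp only [_root_.mul_inv_rev, one_mul, mul_one, hneg, hsi, mul_assoc, hsT, hsT', hss, hadd', ← hadd, hs, hsinj] at hh
        rw [hh]; abel
    · rintro (⟨x, rfl⟩ | ⟨x, rfl⟩)
      · refine ⟨T x, ?_⟩
        rw [hφ]
        simp only [_root_.mul_inv_rev, one_mul, mul_one, hneg, hsi, mul_assoc, hsT, hsT', hss, hadd', ← hadd, hs, hsinj]
        abel
      · refine ⟨T x * s, ?_⟩
        rw [map_mul, hφ, hφs]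
        simp only [_root_.mul_inv_rev, one_mul, mul_one, hneg, hsi, mul_assoc, hsT, hsT', hss, hadd', ← hadd, hs, hsinj]
        abel
  have r12 : ∀ z w, ¬ twistedConj φ (T z) (T w * s) := by
    rintro z w ⟨h, hh⟩
    rcases hall h with ⟨x, rfl⟩ | ⟨x, rfl⟩
    · rw [hφ] at hh
      simp only [_root_.mul_inv_rev, one_mul, mul_one, hneg, hsi, mul_assoc, hsT, hsT', hss, hadd', ← hadd, hs] at hh
      exact hne _ _ hh
    · rw [map_mul, hφ, hφs] at hh
      simp only [_root_.mul_inv_rev, one_mul, mul_one, hneg, hsi, mul_assoc, hsT, hsT', hss, hadd', ← hadd, hs] at hh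
      exact hne _ _ hh
  have heq : Equivalence (twistedConj φ) :=
    { refl := fun g => ⟨1, by simp⟩
      symm := by
        rintro x y ⟨h, rfl⟩
        exact ⟨h⁻¹, by simp [mul_assoc]⟩
      trans := by
        rintro x y z ⟨h, rfl⟩ ⟨k, rfl⟩
        exact ⟨h * k, by simp [mul_assoc]⟩ }
  rw [reidemeisterNumber, ← ENat.card_sum]
  symm
  let F1 : Quot (invRel ((-b : A) : A ⧸ coN f)) → Quot (twistedConj φ) :=
    Quot.lift (fun p : A ⧸ coN f => Quotient.liftOn' p (fun z => Quot.mk (twistedConj φ) (T z))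
      (fun z w h => Quot.sound ((r11 z w).2 (Or.inl (Quotient.sound' h))))) (by
      intro p q
      obtain ⟨z, rfl⟩ := QuotientAddGroup.mk_surjective p
      obtain ⟨w, rfl⟩ := QuotientAddGroup.mk_surjective q
      intro h
      exact Quot.sound ((r11 z w).2 h))
  let F2 : Quot (invRel (b : A ⧸ coN (-f))) → Quot (twistedConj φ) :=
    Quot.lift (fun p : A ⧸ coN (-f) => Quotient.liftOn' p
      (fun z => Quot.mk (twistedConj φ) (T z * s))
      (fun z w h => Quot.sound ((r22 z w).2 (Or.inl (Quotient.sound' h))))) (by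
      intro p q
      obtain ⟨z, rfl⟩ := QuotientAddGroup.mk_surjective p
      obtain ⟨w, rfl⟩ := QuotientAddGroup.mk_surjective q
      intro h
      exact Quot.sound ((r22 z w).2 h))
  refine ENat.card_congr (Equiv.ofBijective (Sum.elim F1 F2) ⟨?_, ?_⟩)
  · rintro (p | p) (q | q) h <;> obtain ⟨p, rfl⟩ := Quot.exists_rep p <;>
      obtain ⟨q, rfl⟩ := Quot.exists_rep q <;>
      obtain ⟨z, rfl⟩ := QuotientAddGroup.mk_surjective p <;>
      obtain ⟨w, rfl⟩ := QuotientAddGroup.mk_surjective q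
    · congr 1
      exact Quot.sound ((r11 z w).1 ((heq.quot_mk_eq_iff _ _).1 h))
    · exact absurd ((heq.quot_mk_eq_iff _ _).1 h) (r12 z w)
    · exact absurd ((heq.quot_mk_eq_iff _ _).1 h.symm) (r12 w z)
    · congr 1
      exact Quot.sound ((r22 z w).1 ((heq.quot_mk_eq_iff _ _).1 h))
  · intro p
    obtain ⟨g, rfl⟩ := Quot.exists_rep p
    rcases hall g with ⟨x, rfl⟩ | ⟨x, rfl⟩
    · exact ⟨Sum.inl (Quot.mk _ (x : A ⧸ coN f)), rfl⟩
    · exact ⟨Sum.inr (Quot.mk _ (x : A ⧸ coN (-f))), rfl⟩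

theorem aut_class {G A : Type*} [Group G] [AddCommGroup A] (T : A → G) (s : G)
    (hadd : ∀ a b, T (a + b) = T a * T b) (hinj : Function.Injective T)
    (hs : s * s = 1) (hsT : ∀ a, s * T a = T (-a) * s)
    (hall : ∀ g, (∃ a, g = T a) ∨ ∃ a, g = T a * s) (hne : ∀ a b, T a ≠ T b * s)
    (htf : ∀ a : A, a + a = 0 → a = 0) (φ : G ≃* G) :
    ∃ (f g : A →+ A) (b : A), (∀ a, φ (T a) = T (f a)) ∧ φ s = T b * s ∧
      (∀ a, f (g a) = a) := by
  have h0 : T 0 = 1 := by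
    have := hadd 0 0
    simpa using this
  have hsq : ∀ a, (T a * s) * (T a * s) = 1 := by
    intro a
    rw [mul_assoc, ← mul_assoc s, hsT, mul_assoc, hs, mul_one, ← hadd, add_neg_cancel, h0]
  have key : ∀ (ψ : G ≃* G) (a : A), ∃ c, ψ (T a) = T c := by
    intro ψ a
    rcases hall (ψ (T a)) with h | ⟨c, hc⟩
    · exact h
    · exfalso
      have h1 : ψ (T (a + a)) = 1 := by rw [hadd, map_mul, hc, hsq]
      have h2 : a = 0 := by
        apply htf
        apply hinj
        rw [h0]
        exact ψ.injective (by rw [h1, map_one])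
      rw [h2, h0, map_one, ← h0] at hc
      exact hne _ _ hc
  have key2 : ∀ ψ : G ≃* G, ∃ f : A →+ A, ∀ a, ψ (T a) = T (f a) := by
    intro ψ
    choose f hf using key ψ
    refine ⟨⟨⟨f, ?_⟩, ?_⟩, hf⟩
    · apply hinj
      rw [← hf, h0, map_one]
    · intro a b
      apply hinj
      show T (f (a + b)) = T (f a + f b)
      rw [← hf, hadd, hadd, map_mul, hf, hf]
  obtain ⟨f, hf⟩ := key2 φ
  obtain ⟨g, hg⟩ := key2 φ.symm
  rcases hall (φ s) with ⟨c, hc⟩ | ⟨b, hb⟩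
  · exfalso
    have h1 : T (c + c) = T 0 := by rw [hadd, ← hc, ← map_mul, hs, map_one, h0]
    have h2 := htf c (hinj h1)
    rw [h2, h0] at hc
    have h3 : s = 1 := φ.injective (by rw [hc, map_one])
    exact hne 0 0 (by rw [h3, mul_one])
  · refine ⟨f, g, b, hf, hb, fun a => ?_⟩
    apply hinj
    rw [← hf, ← hg, MulEquiv.apply_symm_apply]

theorem card_range_det {n : ℕ} (B : Matrix (Fin n) (Fin n) ℤ) (N : AddSubgroup (Fin n → ℤ))
    (hN : ∀ a, a ∈ N ↔ ∃ x, B *ᵥ x = a) (h : B.det ≠ 0) :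
    Nat.card ((Fin n → ℤ) ⧸ N) = B.det.natAbs := by
  have hinj : Function.Injective (Matrix.toLin' B) := by
    rw [← LinearMap.ker_eq_bot, LinearMap.ker_eq_bot']
    intro x hx
    exact Matrix.eq_zero_of_mulVec_eq_zero h (by simpa using hx)
  let e := LinearEquiv.ofInjective (Matrix.toLin' B) hinj
  have h1 := Submodule.natAbs_det_equiv (LinearMap.range (Matrix.toLin' B)) e
  have h2 : ((LinearMap.range (Matrix.toLin' B)).subtype ∘ₗ
      AddMonoidHom.toIntLinearMap (e : (Fin n → ℤ) →+ _)) = Matrix.toLin' B := by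
    ext i
    rfl
  rw [h2, LinearMap.det_toLin'] at h1
  rw [h1]
  have h3 : N = (LinearMap.range (Matrix.toLin' B)).toAddSubgroup := by
    ext a
    rw [hN]
    simp
  rw [h3]
  rfl

theorem det_ne_zero_of_finite {n : ℕ} (B : Matrix (Fin n) (Fin n) ℤ)
    (N : AddSubgroup (Fin n → ℤ))
    (hN : ∀ a, a ∈ N ↔ ∃ x, B *ᵥ x = a) [Finite ((Fin n → ℤ) ⧸ N)] : B.det ≠ 0 := by
  have hk : N.index ≠ 0 := Nat.card_pos.ne'
  have h1 : ∀ i : Fin n, ∃ x, B *ᵥ x = N.index • (Pi.single i 1 : Fin n → ℤ) := fun i =>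
    (hN _).1 (AddSubgroup.nsmul_index_mem N _)
  choose C hC using h1
  have h2 : B * (Matrix.of C)ᵀ = (N.index : ℤ) • (1 : Matrix (Fin n) (Fin n) ℤ) := by
    ext i j
    have := congrFun (hC j) i
    simp only [Matrix.mulVec, dotProduct, Pi.smul_apply, Pi.single_apply] at this
    simp only [Matrix.mul_apply, Matrix.transpose_apply, Matrix.of_apply, Matrix.smul_apply,
      Matrix.one_apply]
    rw [this]
    simp
  intro h
  have h3 := congrArg Matrix.det h2
  rw [Matrix.det_mul, h, zero_mul, Matrix.det_smul, Matrix.det_one, mul_one] at h3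
  exact pow_ne_zero _ (Int.natCast_ne_zero.2 hk) h3.symm

/-! The concrete group -/

theorem neg_one_mulVec' {n : ℕ} (v : Fin n → ℝ) :
    ((-1 : GL (Fin n) ℝ) : Matrix (Fin n) (Fin n) ℝ) *ᵥ v = -v := by
  rw [Units.val_neg, Units.val_one, Matrix.neg_mulVec, Matrix.one_mulVec]

/-- Integer vector as a real vector. -/
def castV {n : ℕ} (z : Fin n → ℤ) : Fin n → ℝ := fun i => (z i : ℝ)

theorem castV_add {n : ℕ} (z w : Fin n → ℤ) : castV (z + w) = castV z + castV w := by
  ext i; simp [castV]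

theorem castV_neg {n : ℕ} (z : Fin n → ℤ) : castV (-z) = - castV z := by
  ext i; simp [castV]

theorem castV_zero {n : ℕ} : castV (0 : Fin n → ℤ) = 0 := by
  ext i; simp [castV]

theorem castV_inj {n : ℕ} : Function.Injective (castV (n := n)) := by
  intro z w h
  ext i
  have := congrFun h i
  simpa [castV] using this

theorem mem_GammaMinus {n : ℕ} (g : Aff n) : g ∈ GammaMinus n ↔
    ∃ z : Fin n → ℤ, g = ⟨castV z, 1⟩ ∨ g = ⟨castV z, -1⟩ := by
  constructor
  · intro hg
    refine Subgroup.closure_induction (p := fun g _ => ∃ z : Fin n → ℤ,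
      g = ⟨castV z, 1⟩ ∨ g = ⟨castV z, -1⟩) ?_ ?_ ?_ ?_ hg
    · rintro x (⟨z, rfl⟩ | rfl)
      · exact ⟨z, Or.inl rfl⟩
      · exact ⟨0, Or.inr (by rw [castV_zero])⟩
    · exact ⟨0, Or.inl (by rw [castV_zero]; rfl)⟩
    · rintro x y - - ⟨z, rfl | rfl⟩ ⟨w, rfl | rfl⟩
      · exact ⟨z + w, Or.inl (by simp [Aff.mul_def, castV_add])⟩
      · exact ⟨z + w, Or.inr (by simp [Aff.mul_def, castV_add])⟩
      · exact ⟨z - w, Or.inr (by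
          rw [Aff.mul_def, neg_one_mulVec', sub_eq_add_neg, castV_add, castV_neg, mul_one])⟩
      · exact ⟨z - w, Or.inl (by
          rw [Aff.mul_def, neg_one_mulVec', sub_eq_add_neg, castV_add, castV_neg]; simp)⟩
    · rintro x - ⟨z, rfl | rfl⟩
      · exact ⟨-z, Or.inl (by simp [Aff.inv_def, castV_neg])⟩
      · refine ⟨z, Or.inr ?_⟩
        have : (-1 : GL (Fin n) ℝ)⁻¹ = -1 := by simp
        rw [Aff.inv_def]
        simp only [this, neg_one_mulVec', neg_neg]
  · have hT : ∀ z : Fin n → ℤ, (⟨castV z, 1⟩ : Aff n) ∈ GammaMinus n := fun z =>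
      Subgroup.subset_closure (Or.inl ⟨z, rfl⟩)
    rintro ⟨z, rfl | rfl⟩
    · exact hT z
    · have h2 : (⟨0, -1⟩ : Aff n) ∈ GammaMinus n := Subgroup.subset_closure (Or.inr rfl)
      have := mul_mem (hT z) h2
      simpa [Aff.mul_def] using this

/-- Translations. -/
def gT {n : ℕ} (z : Fin n → ℤ) : GammaMinus n :=
  ⟨⟨castV z, 1⟩, (mem_GammaMinus _).2 ⟨z, Or.inl rfl⟩⟩

/-- The central symmetry. -/
def gS (n : ℕ) : GammaMinus n :=
  ⟨⟨castV 0, -1⟩, (mem_GammaMinus _).2 ⟨0, Or.inr rfl⟩⟩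

theorem gT_mul_gS {n : ℕ} (z : Fin n → ℤ) : ((gT z * gS n : GammaMinus n) : Aff n)
    = ⟨castV z, -1⟩ := by
  show (⟨castV z, 1⟩ : Aff n) * ⟨castV 0, -1⟩ = _
  simp [Aff.mul_def, castV_zero]

theorem gT_add {n : ℕ} (a b : Fin n → ℤ) : gT (a + b) = gT a * gT b := by
  apply Subtype.ext
  show (⟨castV (a + b), 1⟩ : Aff n) = (⟨castV a, 1⟩ : Aff n) * ⟨castV b, 1⟩
  simp [Aff.mul_def, castV_add]

theorem gT_inj {n : ℕ} : Function.Injective (gT (n := n)) := by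
  intro a b h
  exact castV_inj (congrArg (fun g : GammaMinus n => (g : Aff n).tr) h)

theorem gS_sq (n : ℕ) : gS n * gS n = 1 := by
  apply Subtype.ext
  show (⟨castV 0, -1⟩ : Aff n) * ⟨castV 0, -1⟩ = ⟨0, 1⟩
  simp [Aff.mul_def, castV_zero]

theorem gS_gT {n : ℕ} (a : Fin n → ℤ) : gS n * gT a = gT (-a) * gS n := by
  apply Subtype.ext
  rw [gT_mul_gS]
  show (⟨castV 0, -1⟩ : Aff n) * ⟨castV a, 1⟩ = _
  rw [Aff.mul_def, neg_one_mulVec', castV_zero, castV_neg, zero_add, mul_one]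

theorem g_all {n : ℕ} (g : GammaMinus n) : (∃ a, g = gT a) ∨ ∃ a, g = gT a * gS n := by
  obtain ⟨z, h | h⟩ := (mem_GammaMinus _).1 g.2
  · exact Or.inl ⟨z, Subtype.ext h⟩
  · exact Or.inr ⟨z, Subtype.ext (by rw [gT_mul_gS]; exact h)⟩

theorem g_ne {n : ℕ} (hn : 2 ≤ n) (a b : Fin n → ℤ) : gT a ≠ gT b * gS n := by
  intro h
  have h := congrArg Subtype.val h
  rw [gT_mul_gS] at h
  have h : (1 : GL (Fin n) ℝ) = -1 := congrArg Aff.lin h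
  have h := congrArg (fun M : GL (Fin n) ℝ => (M : Matrix (Fin n) (Fin n) ℝ) ⟨0, by omega⟩
    ⟨0, by omega⟩) h
  simp at h
  norm_num at h

theorem reid_gamma {n : ℕ} (hn : 2 ≤ n) (φ : GammaMinus n →* GammaMinus n)
    (f : (Fin n → ℤ) →+ (Fin n → ℤ)) (b : Fin n → ℤ) (hφ : ∀ a, φ (gT a) = gT (f a))
    (hφs : φ (gS n) = gT b * gS n) :
    reidemeisterNumber φ = ENat.card (Quot (invRel ((-b : Fin n → ℤ) : (Fin n → ℤ) ⧸ coN f))) +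
      ENat.card (Quot (invRel (b : (Fin n → ℤ) ⧸ coN (-f)))) :=
  reid_equiv gT (gS n) gT_add gT_inj (gS_sq n) gS_gT g_all (g_ne hn) φ f b hφ hφs

theorem aut_gamma {n : ℕ} (hn : 2 ≤ n) (φ : GammaMinus n ≃* GammaMinus n) :
    ∃ (f g : (Fin n → ℤ) →+ (Fin n → ℤ)) (b : Fin n → ℤ), (∀ a, φ (gT a) = gT (f a)) ∧
      φ (gS n) = gT b * gS n ∧ (∀ a, f (g a) = a) :=
  aut_class gT (gS n) gT_add gT_inj (gS_sq n) gS_gT g_all (g_ne hn) (fun a h => by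
    ext i
    have := congrFun h i
    simp at this
    simpa using this) φ

/-- The automorphism of the group induced by an integral matrix. -/
theorem exists_aut {n : ℕ} (M : Matrix (Fin n) (Fin n) ℤ) (hM : IsUnit M.det) :
    ∃ φ : GammaMinus n ≃* GammaMinus n, (∀ a, φ (gT a) = gT (M *ᵥ a)) ∧
      φ (gS n) = gT 0 * gS n := by
  let P : GL (Fin n) ℤ := Matrix.GeneralLinearGroup.mk'' M hM
  let ρ : GL (Fin n) ℤ →* GL (Fin n) ℝ := Matrix.GeneralLinearGroup.map (Int.castRingHom ℝ)
  have hρ : ∀ (Q : GL (Fin n) ℤ) (z : Fin n → ℤ),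
      ((ρ Q : GL (Fin n) ℝ) : Matrix (Fin n) (Fin n) ℝ) *ᵥ castV z =
        castV ((Q : Matrix (Fin n) (Fin n) ℤ) *ᵥ z) := by
    intro Q z
    ext i
    simp [ρ, castV, Matrix.mulVec, dotProduct]
  have hc : ∀ (Q : GL (Fin n) ℤ) (z : Fin n → ℤ) (ε : GL (Fin n) ℝ) (hε : ε = 1 ∨ ε = -1),
      (⟨0, ρ Q⟩ : Aff n) * ⟨castV z, ε⟩ * (⟨0, ρ Q⟩ : Aff n)⁻¹ =
        ⟨castV ((Q : Matrix (Fin n) (Fin n) ℤ) *ᵥ z), ε⟩ := by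
    intro Q z ε hε
    rw [mul_inv_eq_iff_eq_mul, Aff.mul_def, Aff.mul_def]
    simp only [hρ, Matrix.mulVec_zero, zero_add, add_zero]
    rcases hε with rfl | rfl <;> simp
  have hmem : ∀ (Q : GL (Fin n) ℤ) (g : Aff n), g ∈ GammaMinus n →
      (⟨0, ρ Q⟩ : Aff n) * g * (⟨0, ρ Q⟩ : Aff n)⁻¹ ∈ GammaMinus n := by
    intro Q g hg
    obtain ⟨z, rfl | rfl⟩ := (mem_GammaMinus _).1 hg
    · rw [hc Q z 1 (Or.inl rfl)]
      exact (mem_GammaMinus _).2 ⟨_, Or.inl rfl⟩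
    · rw [hc Q z (-1) (Or.inr rfl)]
      exact (mem_GammaMinus _).2 ⟨_, Or.inr rfl⟩
  have hinv : (⟨0, ρ P⁻¹⟩ : Aff n) = (⟨0, ρ P⟩ : Aff n)⁻¹ := by
    rw [Aff.inv_def, map_inv]
    simp
  refine ⟨{ toFun := fun x => ⟨_, hmem P x x.2⟩
            invFun := fun x => ⟨_, hmem P⁻¹ x x.2⟩
            left_inv := ?_
            right_inv := ?_
            map_mul' := ?_ }, ?_, ?_⟩
  · intro x
    apply Subtype.ext
    simp only [hinv]
    group
  · intro x
    apply Subtype.ext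
    simp only [hinv]
    group
  · intro x y
    apply Subtype.ext
    simp only [Subgroup.coe_mul]
    group
  · intro a
    exact Subtype.ext (hc P a 1 (Or.inl rfl))
  · apply Subtype.ext
    rw [gT_mul_gS]
    refine (hc P 0 (-1) (Or.inr rfl)).trans ?_
    rw [Matrix.mulVec_zero]

theorem mem_coN_matrix {n : ℕ} (M : Matrix (Fin n) (Fin n) ℤ)
    (f : (Fin n → ℤ) →+ (Fin n → ℤ)) (hf : ∀ x, f x = M *ᵥ x) (a : Fin n → ℤ) :
    a ∈ coN f ↔ ∃ x, (1 - M) *ᵥ x = a := by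
  rw [mem_coN]
  exact exists_congr fun x => by rw [hf, Matrix.sub_mulVec, Matrix.one_mulVec]

theorem mem_coN_matrix' {n : ℕ} (M : Matrix (Fin n) (Fin n) ℤ)
    (f : (Fin n → ℤ) →+ (Fin n → ℤ)) (hf : ∀ x, f x = M *ᵥ x) (a : Fin n → ℤ) :
    a ∈ coN (-f) ↔ ∃ x, (1 + M) *ᵥ x = a := by
  rw [mem_coN]
  exact exists_congr fun x => by
    rw [AddMonoidHom.neg_apply, hf, Matrix.add_mulVec, Matrix.one_mulVec, sub_neg_eq_add]

theorem reid_formula {n : ℕ} (hn : 2 ≤ n) (φ : GammaMinus n →* GammaMinus n)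
    (M : Matrix (Fin n) (Fin n) ℤ) (b : Fin n → ℤ)
    (hφ : ∀ a, φ (gT a) = gT (M *ᵥ a)) (hφs : φ (gS n) = gT b * gS n)
    (h1 : (1 - M).det ≠ 0) (h2 : (1 + M).det ≠ 0) :
    ∃ r F : ℕ, reidemeisterNumber φ = r ∧
      2 * r = (1 - M).det.natAbs + (1 + M).det.natAbs + 2 * F ∧
      (Odd (1 - M).det.natAbs → F = 1) ∧ (Even (1 - M).det.natAbs → Even F) := by
  let f : (Fin n → ℤ) →+ (Fin n → ℤ) := (Matrix.mulVecLin M).toAddMonoidHom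
  have hf : ∀ x, f x = M *ᵥ x := fun x => rfl
  have c1 := card_range_det _ _ (mem_coN_matrix M f hf) h1
  have c2 := card_range_det _ _ (mem_coN_matrix' M f hf) h2
  have : Finite ((Fin n → ℤ) ⧸ coN f) :=
    Nat.finite_of_card_ne_zero (by rw [c1]; exact Int.natAbs_ne_zero.2 h1)
  have : Finite ((Fin n → ℤ) ⧸ coN (-f)) :=
    Nat.finite_of_card_ne_zero (by rw [c2]; exact Int.natAbs_ne_zero.2 h2)
  have e1 := two_mul_card_invRel ((-b : Fin n → ℤ) : (Fin n → ℤ) ⧸ coN f)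
  have e2 := two_mul_card_invRel (b : (Fin n → ℤ) ⧸ coN (-f))
  have e3 := card_halves_eq f b
  have e4 := card_halves_odd ((-b : Fin n → ℤ) : (Fin n → ℤ) ⧸ coN f)
  rw [← e3] at e2
  rw [c1] at e1 e4
  rw [c2] at e2
  refine ⟨Nat.card (Quot (invRel ((-b : Fin n → ℤ) : (Fin n → ℤ) ⧸ coN f))) +
    Nat.card (Quot (invRel (b : (Fin n → ℤ) ⧸ coN (-f)))), _, ?_, ?_, e4, ?_⟩
  · rw [reid_gamma hn φ f b hφ hφs, ENat.card_eq_coe_natCard, ENat.card_eq_coe_natCard,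
      ← Nat.cast_add]
  · rw [mul_add, e1, e2]; ring
  · intro h
    have : Even (2 * Nat.card (Quot (invRel ((-b : Fin n → ℤ) : (Fin n → ℤ) ⧸ coN f)))) :=
      even_two_mul _
    rw [e1] at this
    exact (Nat.even_add.1 this).1 h

theorem reid_top {n : ℕ} (hn : 2 ≤ n) (φ : GammaMinus n →* GammaMinus n)
    (M : Matrix (Fin n) (Fin n) ℤ) (b : Fin n → ℤ)
    (hφ : ∀ a, φ (gT a) = gT (M *ᵥ a)) (hφs : φ (gS n) = gT b * gS n)
    (h : (1 - M).det = 0 ∨ (1 + M).det = 0) : reidemeisterNumber φ = ⊤ := by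
  let f : (Fin n → ℤ) →+ (Fin n → ℤ) := (Matrix.mulVecLin M).toAddMonoidHom
  have hf : ∀ x, f x = M *ᵥ x := fun x => rfl
  rw [reid_gamma hn φ f b hφ hφs]
  rcases h with h | h
  · have : Infinite (Quot (invRel ((-b : Fin n → ℤ) : (Fin n → ℤ) ⧸ coN f))) := by
      rw [← not_finite_iff_infinite]
      intro hfin
      have := infinite_invRel ((-b : Fin n → ℤ) : (Fin n → ℤ) ⧸ coN f)
      exact det_ne_zero_of_finite _ _ (mem_coN_matrix M f hf) h
    rw [ENat.card_eq_top.2 this, top_add]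
  · have : Infinite (Quot (invRel (b : (Fin n → ℤ) ⧸ coN (-f)))) := by
      rw [← not_finite_iff_infinite]
      intro hfin
      have := infinite_invRel (b : (Fin n → ℤ) ⧸ coN (-f))
      exact det_ne_zero_of_finite _ _ (mem_coN_matrix' M f hf) h
    rw [ENat.card_eq_top.2 this, add_top]

theorem aut_matrix {n : ℕ} (hn : 2 ≤ n) (φ : GammaMinus n ≃* GammaMinus n) :
    ∃ (M : Matrix (Fin n) (Fin n) ℤ) (b : Fin n → ℤ), (∀ a, φ (gT a) = gT (M *ᵥ a)) ∧
      φ (gS n) = gT b * gS n ∧ IsUnit M.det := by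
  obtain ⟨f, g, b, hf, hb, hfg⟩ := aut_gamma hn φ
  have hm : ∀ (h : (Fin n → ℤ) →+ (Fin n → ℤ)) a,
      (LinearMap.toMatrix' h.toIntLinearMap) *ᵥ a = h a := by
    intro h a
    rw [LinearMap.toMatrix'_mulVec]
    rfl
  refine ⟨LinearMap.toMatrix' f.toIntLinearMap, b, fun a => by rw [hm, hf], hb, ?_⟩
  have : LinearMap.toMatrix' f.toIntLinearMap * LinearMap.toMatrix' g.toIntLinearMap = 1 := by
    rw [← LinearMap.toMatrix'_comp, ← LinearMap.toMatrix'_id]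
    congr 1
    ext1 a
    ext1
    simp [hfg]
  have h2 := congrArg Matrix.det this
  rw [Matrix.det_mul, Matrix.det_one] at h2
  exact IsUnit.of_mul_eq_one _ h2

theorem realize {n : ℕ} (hn : 2 ≤ n) (M : Matrix (Fin n) (Fin n) ℤ) (hM : IsUnit M.det)
    (r : ℕ) (h1 : Odd (1 - M).det.natAbs) (h2 : (1 + M).det ≠ 0)
    (hr : 2 * r = (1 - M).det.natAbs + (1 + M).det.natAbs + 2) :
    (r : ℕ∞) ∈ reidemeisterSpectrum (GammaMinus n) := by
  obtain ⟨φ, hφ, hφs⟩ := exists_aut M hM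
  have h1' : (1 - M).det ≠ 0 := by
    intro h
    rw [h] at h1
    simp at h1
  obtain ⟨r', F, e1, e2, e3, -⟩ := reid_formula hn (φ : GammaMinus n →* GammaMinus n) M 0 hφ hφs h1' h2
  have := e3 h1
  refine ⟨φ, ?_⟩
  rw [e1]
  congr 1
  omega

theorem realize_top {n : ℕ} (hn : 2 ≤ n) :
    (⊤ : ℕ∞) ∈ reidemeisterSpectrum (GammaMinus n) := by
  obtain ⟨φ, hφ, hφs⟩ := exists_aut (1 : Matrix (Fin n) (Fin n) ℤ) (by simp)
  have : Nonempty (Fin n) := ⟨⟨0, by omega⟩⟩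
  exact ⟨φ, reid_top hn _ 1 0 hφ hφs (Or.inl (by rw [sub_self, Matrix.det_zero]))⟩

theorem exists_mat (m : ℕ) (hm : 1 ≤ m) : ∀ n : ℕ, 3 ≤ n →
    ∃ M : Matrix (Fin n) (Fin n) ℤ, IsUnit M.det ∧ (1 - M).det.natAbs = 1 ∧
      (1 + M).det.natAbs = 2 * m - 1 := by
  intro n
  induction n using Nat.strong_induction_on with
  | _ n ih =>
    intro hn
    by_cases h3 : n = 3
    · subst h3
      refine ⟨!![0, 0, -1; 1, 0, (m : ℤ); 0, 1, 1 - (m : ℤ)], ?_, ?_, ?_⟩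
      · simp [Matrix.det_fin_three]
      · simp only [Matrix.one_fin_three, Matrix.det_fin_three]
        simp
      · simp only [Matrix.one_fin_three, Matrix.det_fin_three]
        simp
        omega
    by_cases h4 : n = 4
    · subst h4
      refine ⟨!![0, 0, 0, 1; 1, 0, 0, (m : ℤ) - 1; 0, 1, 0, -(m : ℤ); 0, 0, 1, 0], ?_, ?_, ?_⟩
      · simp [Matrix.det_succ_row_zero, Fin.sum_univ_succ, Fin.succAbove]
      · simp [Matrix.det_succ_row_zero, Fin.sum_univ_succ, Fin.succAbove, Matrix.one_apply]
      · simp [Matrix.det_succ_row_zero, Fin.sum_univ_succ, Fin.succAbove, Matrix.one_apply]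
        omega
    obtain ⟨k, rfl⟩ : ∃ k, n = k + 2 := ⟨n - 2, by omega⟩
    obtain ⟨M, h1, h2, h3⟩ := ih k (by omega) (by omega)
    let B : Matrix (Fin 2) (Fin 2) ℤ := !![0, 1; 1, 1]
    let N : Matrix (Fin k ⊕ Fin 2) (Fin k ⊕ Fin 2) ℤ := Matrix.fromBlocks M 0 0 B
    have e1 : (1 : Matrix (Fin k ⊕ Fin 2) (Fin k ⊕ Fin 2) ℤ) - N =
        Matrix.fromBlocks (1 - M) 0 0 (1 - B) := by
      rw [← Matrix.fromBlocks_one, sub_eq_add_neg, Matrix.fromBlocks_neg, Matrix.fromBlocks_add]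
      simp [sub_eq_add_neg]
    have e2 : (1 : Matrix (Fin k ⊕ Fin 2) (Fin k ⊕ Fin 2) ℤ) + N =
        Matrix.fromBlocks (1 + M) 0 0 (1 + B) := by
      rw [← Matrix.fromBlocks_one, Matrix.fromBlocks_add]; simp
    have b0 : B.det = -1 := by simp [B, Matrix.det_fin_two]
    have b1 : (1 - B).det = -1 := by simp [B, Matrix.det_fin_two, Matrix.one_fin_two]
    have b2 : (1 + B).det = 1 := by simp [B, Matrix.det_fin_two, Matrix.one_fin_two]
    refine ⟨Matrix.reindexAlgEquiv ℤ ℤ finSumFinEquiv N, ?_, ?_, ?_⟩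
    · rw [Matrix.det_reindexAlgEquiv, Matrix.det_fromBlocks_zero₂₁, b0]
      exact h1.mul (by simp)
    · rw [← map_one (Matrix.reindexAlgEquiv ℤ ℤ finSumFinEquiv), ← map_sub,
        Matrix.det_reindexAlgEquiv, e1, Matrix.det_fromBlocks_zero₂₁, b1]
      simpa using h2
    · rw [← map_one (Matrix.reindexAlgEquiv ℤ ℤ finSumFinEquiv), ← map_add,
        Matrix.det_reindexAlgEquiv, e2, Matrix.det_fromBlocks_zero₂₁, b2]
      simpa using h3

theorem case_two : reidemeisterSpectrum ↥(GammaMinus 2) =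
        {r : ℕ∞ | (∃ k : ℕ, 0 < k ∧ r = 2 * k) ∨ r = 3 ∨ r = ⊤} := by
  ext r
  constructor
  · rintro ⟨φ, rfl⟩
    obtain ⟨M, b, hφ, hφs, hM⟩ := aut_matrix le_rfl φ
    by_cases h : (1 - M).det = 0 ∨ (1 + M).det = 0
    · exact Or.inr (Or.inr (reid_top le_rfl (φ : GammaMinus 2 →* GammaMinus 2) M b hφ hφs h))
    push Not at h
    obtain ⟨r, F, e1, e2, e3, e4⟩ :=
      reid_formula le_rfl (φ : GammaMinus 2 →* GammaMinus 2) M b hφ hφs h.1 h.2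
    have d1 : (1 - M).det = 1 - (M 0 0 + M 1 1) + M.det := by
      simp [Matrix.det_fin_two]; ring
    have d2 : (1 + M).det = 1 + (M 0 0 + M 1 1) + M.det := by
      simp [Matrix.det_fin_two]; ring
    obtain ⟨h1, h2⟩ := h
    rw [d1] at e2 e3 e4 h1
    rw [d2] at e2 h2
    generalize M 0 0 + M 1 1 = t at *
    rw [e1]
    have hr : (Even r ∧ 0 < r) ∨ r = 3 := by
      rw [Nat.odd_iff] at e3
      rw [Nat.even_iff, Nat.even_iff] at e4
      rw [Nat.even_iff]
      rcases Int.isUnit_iff.1 hM with hd | hd <;> rw [hd] at e2 e3 e4 h1 h2 <;> omega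
    rcases hr with ⟨⟨k, rfl⟩, h0⟩ | rfl
    · exact Or.inl ⟨k, by omega, by push_cast; rw [two_mul]⟩
    · exact Or.inr (Or.inl rfl)
  · rintro (⟨k, hk, rfl⟩ | rfl | rfl)
    · have := realize le_rfl !![0, 1; 1, 2 * (k : ℤ) - 1] (by simp [Matrix.det_fin_two]) (2 * k)
      have d1 : (1 - !![0, 1; 1, 2 * (k : ℤ) - 1]).det = 1 - 2 * k := by
        simp [Matrix.det_fin_two, Matrix.one_fin_two]
        try ring
      have d2 : (1 + !![0, 1; 1, 2 * (k : ℤ) - 1]).det = 2 * k - 1 := by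
        simp [Matrix.det_fin_two, Matrix.one_fin_two]
        try ring
      rw [d1, d2, Nat.odd_iff] at this
      have := this (by omega) (by omega) (by omega)
      simpa using this
    · have := realize le_rfl !![0, -1; 1, 1] (by simp [Matrix.det_fin_two]) 3
      have d1 : (1 - !![0, -1; 1, (1 : ℤ)]).det = 1 := by
        simp [Matrix.det_fin_two, Matrix.one_fin_two]
      have d2 : (1 + !![0, -1; 1, (1 : ℤ)]).det = 3 := by
        simp [Matrix.det_fin_two, Matrix.one_fin_two]
      rw [d1, d2] at this
      exact this (by simp) (by simp) (by simp)
    · exact realize_top le_rfl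

theorem case_three {n : ℕ} (hn : 3 ≤ n) : reidemeisterSpectrum ↥(GammaMinus n) =
        {r : ℕ∞ | (∃ k : ℕ, 2 ≤ k ∧ r = (k : ℕ∞)) ∨ r = ⊤} := by
  have hn2 : 2 ≤ n := by omega
  ext r
  constructor
  · rintro ⟨φ, rfl⟩
    obtain ⟨M, b, hφ, hφs, hM⟩ := aut_matrix hn2 φ
    by_cases h : (1 - M).det = 0 ∨ (1 + M).det = 0
    · exact Or.inr (reid_top hn2 (φ : GammaMinus n →* GammaMinus n) M b hφ hφs h)
    push Not at h
    obtain ⟨r, F, e1, e2, e3, e4⟩ :=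
      reid_formula hn2 (φ : GammaMinus n →* GammaMinus n) M b hφ hφs h.1 h.2
    refine Or.inl ⟨r, ?_, e1⟩
    rw [Nat.odd_iff] at e3
    have := Int.natAbs_pos.2 h.1
    have := Int.natAbs_pos.2 h.2
    by_contra hlt
    have h5 : (1 - M).det.natAbs = 1 := by omega
    have := e3 (by omega)
    omega
  · rintro (⟨k, hk, rfl⟩ | rfl)
    · obtain ⟨M, h1, h2, h3⟩ := exists_mat (k - 1) (by omega) n hn
      refine realize hn2 M h1 k (by rw [h2]; simp) ?_ (by omega)
      rw [← Int.natAbs_ne_zero]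
      omega
    · exact realize_top hn2



/-- The Reidemeister spectrum of `Γₙ⁻ = ⟨ℤⁿ, (0,-Iₙ)⟩`: for `n = 2` it is
`2ℕ ∪ {3, ∞}`, and for `n ≥ 3` it is `(ℕ \ {1}) ∪ {∞}`. -/
theorem stmt16 {n : ℕ} (hn : 2 ≤ n) :
    (n = 2 → reidemeisterSpectrum ↥(GammaMinus n) =
        {r : ℕ∞ | (∃ k : ℕ, 0 < k ∧ r = 2 * k) ∨ r = 3 ∨ r = ⊤}) ∧
    (3 ≤ n → reidemeisterSpectrum ↥(GammaMinus n) =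
        {r : ℕ∞ | (∃ k : ℕ, 2 ≤ k ∧ r = (k : ℕ∞)) ∨ r = ⊤}) := by
  exact ⟨fun h => by subst h; exact case_two, fun h => case_three h⟩
end
end

section
/- Let M = [[1,−1,0],[0,−1,0],[0,0,−1]] ∈ GL₃(ℤ), let Γ be the subgroup of Aff(ℝ³) generated by the translations ℤ³ × {I₃} together with (0, M) (the crystallographic group 3/2/1/2/1, with holonomy group F = {I₃, M}), and let (d,D) ∈ Aff(ℝ³) be such that ξ_{(d,D)} is an automorphism of Γ. Let δ = 1 if the third component d₃ of d is an integer and δ = 0 otherwise. Then R(ξ_{(d,D)}) = (|det(I₃ − D)|_∞ + |det(I₃ − MD)|_∞)/2 + 4δ, computed in ℕ ∪ {∞}. -/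
open Matrix

noncomputable section

/-- The matrix `M = [[1,-1,0],[0,-1,0],[0,0,-1]]` over `ℝ`. -/
def Mmat : Matrix (Fin 3) (Fin 3) ℝ := !![1,-1,0; 0,-1,0; 0,0,-1]

/-- The matrix `M = [[1,-1,0],[0,-1,0],[0,0,-1]]` over `ℤ`. -/
def MZ : Matrix (Fin 3) (Fin 3) ℤ := !![1,-1,0; 0,-1,0; 0,0,-1]

lemma Mmat_mul_self : Mmat * Mmat = 1 := by
  show (!![1,-1,0; 0,-1,0; 0,0,-1] : Matrix (Fin 3) (Fin 3) ℝ) * !![1,-1,0; 0,-1,0; 0,0,-1] = 1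
  rw [Matrix.mul_fin_three, Matrix.one_fin_three]
  norm_num

/-- `M` as an element of `GL₃(ℝ)`. -/
def MGL : GL (Fin 3) ℝ := ⟨Mmat, Mmat, Mmat_mul_self, Mmat_mul_self⟩

/-- The crystallographic group `3/2/1/2/1`, generated by the translations `ℤ³ × {I₃}`
together with `(0, M)`. -/
def Gamma3 : Subgroup (Aff 3) :=
  Subgroup.closure
    ({g : Aff 3 | ∃ z : Fin 3 → ℤ, g = Aff.mk (fun i => (z i : ℝ)) 1} ∪ {Aff.mk 0 MGL})



theorem card_orbit_involution {Q : Type*} (σ : Q → Q) (hσ : ∀ q, σ (σ q) = q) :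
    2 * ENat.card (Quot (fun a b : Q => a = b ∨ a = σ b)) =
      ENat.card Q + ENat.card {q : Q // σ q = q} := by
  classical
  set r : Q → Q → Prop := fun a b : Q => a = b ∨ a = σ b with hr
  have heq : Equivalence r := by
    refine ⟨fun a => Or.inl rfl, ?_, ?_⟩
    · rintro a b (h | h)
      · exact Or.inl h.symm
      · right; rw [h, hσ]
    · rintro a b c (h | h) (h' | h')
      · left; rw [h, h']
      · right; rw [h, h']
      · right; rw [h, h']
      · left; rw [h, h', hσ]
  have hout : ∀ c : Quot r, Quot.mk r c.out = c := fun c => Quot.out_eq c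
  have hmk : ∀ a b, Quot.mk r a = Quot.mk r b ↔ (a = b ∨ a = σ b) :=
    fun a b => heq.quot_mk_eq_iff a b
  let F : Quot r ⊕ Quot r → Q ⊕ {q : Q // σ q = q} := fun x => match x with
    | Sum.inl c => Sum.inl c.out
    | Sum.inr c => if h : σ c.out = c.out then Sum.inr ⟨c.out, h⟩ else Sum.inl (σ c.out)
  have hF1 : ∀ c, F (Sum.inl c) = Sum.inl c.out := fun c => rfl
  have hF2 : ∀ c, F (Sum.inr c) =
    if h : σ c.out = c.out then Sum.inr ⟨c.out, h⟩ else Sum.inl (σ c.out) := fun c => rfl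
  have hmix : ∀ c c' : Quot r, c.out = σ c'.out → σ c'.out = c'.out := by
    intro c c' h
    have : c = c' := by
      rw [← hout c, ← hout c', hmk]; exact Or.inr h
    subst this
    exact h.symm
  have hbij : Function.Bijective F := by
    constructor
    · rintro (c | c) (c' | c') h
      · rw [hF1, hF1] at h
        have := Sum.inl.inj h
        rw [← hout c, this, hout]
      · rw [hF1, hF2] at h
        split_ifs at h with h1
        exact absurd (hmix _ _ (Sum.inl.inj h)) h1
      · rw [hF1, hF2] at h
        split_ifs at h with h1
        exact absurd (hmix _ _ (Sum.inl.inj h).symm) h1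
      · rw [hF2, hF2] at h
        split_ifs at h with h1 h2 h2
        · have := congrArg Subtype.val (Sum.inr.inj h)
          simp only at this
          rw [← hout c, this, hout]
        · have h3 := congrArg σ (Sum.inl.inj h)
          rw [hσ, hσ] at h3
          rw [← hout c, h3, hout]
    · have key : ∀ q : Q, (Quot.mk r q).out = q ∨ (Quot.mk r q).out = σ q := by
        intro q
        exact (hmk _ _).1 (hout _)
      rintro (q | ⟨q, hq⟩)
      · rcases key q with h | h
        · exact ⟨Sum.inl (Quot.mk r q), by rw [hF1, h]⟩
        · by_cases h1 : σ q = q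
          · exact ⟨Sum.inl (Quot.mk r q), by rw [hF1, h, h1]⟩
          · refine ⟨Sum.inr (Quot.mk r q), ?_⟩
            rw [hF2, dif_neg, h, hσ]
            rw [h, hσ]; exact fun h => h1 h.symm
      · have h : (Quot.mk r q).out = q := by
          rcases key q with h | h
          · exact h
          · rw [h, hq]
        refine ⟨Sum.inr (Quot.mk r q), ?_⟩
        rw [hF2, dif_pos (by rw [h, hq])]
        congr 1
        exact Subtype.ext h
  have := ENat.card_congr (Equiv.ofBijective F hbij)
  rw [ENat.card_sum, ENat.card_sum] at this
  rw [two_mul, this]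

/-- Range of an integer matrix, as an additive subgroup. -/
def rng (A : Matrix (Fin 3) (Fin 3) ℤ) : AddSubgroup (Fin 3 → ℤ) :=
  (LinearMap.range A.mulVecLin).toAddSubgroup

theorem mem_rng (A : Matrix (Fin 3) (Fin 3) ℤ) (v : Fin 3 → ℤ) :
    v ∈ rng A ↔ ∃ w, A *ᵥ w = v := by
  simp [rng]

theorem index_rng (A : Matrix (Fin 3) (Fin 3) ℤ) (h : A.det ≠ 0) :
    (rng A).index = A.det.natAbs := by
  have hinj : Function.Injective A.mulVecLin := by
    intro x y hxy
    by_contra hne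
    apply h
    rw [← Matrix.exists_mulVec_eq_zero_iff]
    refine ⟨x - y, sub_ne_zero.2 hne, ?_⟩
    simp only [Matrix.mulVecLin_apply] at hxy
    rw [Matrix.mulVec_sub, hxy, sub_self]
  have := Submodule.natAbs_det_equiv (LinearMap.range A.mulVecLin)
    (LinearEquiv.ofInjective A.mulVecLin hinj)
  rw [AddSubgroup.index_eq_card]
  have h2 : Nat.card ((Fin 3 → ℤ) ⧸ rng A) = Nat.card ((Fin 3 → ℤ) ⧸ LinearMap.range A.mulVecLin) := rfl
  rw [h2, ← this]
  congr 1
  rw [← LinearMap.det_toLin', Matrix.toLin'_apply']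
  congr 1

theorem infinite_rng (A : Matrix (Fin 3) (Fin 3) ℤ) (h : A.det = 0) :
    Infinite ((Fin 3 → ℤ) ⧸ rng A) := by
  by_contra hfin
  rw [not_infinite_iff_finite] at hfin
  have hn : (rng A).index ≠ 0 := by
    rw [AddSubgroup.index_eq_card]; exact Nat.card_pos.ne'
  have h1 : ∀ v : Fin 3 → ℤ, ∃ w, A *ᵥ w = (rng A).index • v := fun v =>
    (mem_rng A _).1 (AddSubgroup.nsmul_index_mem (rng A) v)
  choose f hf using h1
  set B : Matrix (Fin 3) (Fin 3) ℤ := Matrix.of fun i j => f (Pi.single j 1) i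
  have hB : A * B = ((rng A).index : ℤ) • (1 : Matrix (Fin 3) (Fin 3) ℤ) := by
    ext i j
    have := congrFun (hf (Pi.single j 1)) i
    simp only [Matrix.mulVec, dotProduct] at this
    simp only [Matrix.mul_apply, B, Matrix.of_apply, this]
    simp [Matrix.one_apply, Pi.single_apply]
  have := congrArg Matrix.det hB
  rw [Matrix.det_mul, h, zero_mul, Matrix.det_smul] at this
  simp at this
  exact hn (by exact_mod_cast (pow_eq_zero_iff (by norm_num)).1 this.symm)

theorem card_rng (A : Matrix (Fin 3) (Fin 3) ℤ) :
    ENat.card ((Fin 3 → ℤ) ⧸ rng A) = intAbsInfty A.det := by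
  unfold intAbsInfty
  split_ifs with h
  · rw [ENat.card_eq_top]; exact infinite_rng A h
  · have h1 := index_rng A h
    rw [← h1, AddSubgroup.index_eq_card]
    have : Finite ((Fin 3 → ℤ) ⧸ rng A) := by
      apply Nat.finite_of_card_ne_zero
      rw [← AddSubgroup.index_eq_card, h1]
      simpa using h
    simp [ENat.card_eq_coe_natCard]

/-- The involution `q ↦ M q + t` on `ℤ³ / (1 - A) ℤ³`. -/
def sig (A : Matrix (Fin 3) (Fin 3) ℤ) (hc : MZ * A = A * MZ) (t : Fin 3 → ℤ) :
    (Fin 3 → ℤ) ⧸ rng (1 - A) → (Fin 3 → ℤ) ⧸ rng (1 - A) := fun q =>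
  QuotientAddGroup.map (rng (1 - A)) (rng (1 - A)) MZ.mulVecLin.toAddMonoidHom (by
    intro v hv
    rw [mem_rng] at hv
    obtain ⟨w, rfl⟩ := hv
    rw [AddSubgroup.mem_comap, mem_rng]
    refine ⟨MZ *ᵥ w, ?_⟩
    simp only [LinearMap.toAddMonoidHom_coe, Matrix.mulVecLin_apply, Matrix.mulVec_mulVec]
    congr 1
    rw [sub_mul, mul_sub, hc, one_mul, mul_one]) q + QuotientAddGroup.mk t

theorem sig_mk (A : Matrix (Fin 3) (Fin 3) ℤ) (hc : MZ * A = A * MZ) (t v : Fin 3 → ℤ) :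
    sig A hc t (QuotientAddGroup.mk v) = QuotientAddGroup.mk (MZ *ᵥ v + t) := rfl

theorem MZ_mulVec (v : Fin 3 → ℤ) : MZ *ᵥ v = ![v 0 - v 1, - v 1, - v 2] := by
  ext i
  fin_cases i <;> simp [MZ, Matrix.mulVec, dotProduct, Fin.sum_univ_three]; ring

theorem sig_sig (A : Matrix (Fin 3) (Fin 3) ℤ) (hc : MZ * A = A * MZ) (t : Fin 3 → ℤ)
    (ht : t 1 = 2 * t 0) (q) : sig A hc t (sig A hc t q) = q := by
  induction q using QuotientAddGroup.induction_on with
  | H v =>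
    rw [sig_mk, sig_mk]
    congr 1
    rw [MZ_mulVec, MZ_mulVec]
    ext i
    fin_cases i <;> simp <;> linarith

theorem exists_shape (A : Matrix (Fin 3) (Fin 3) ℤ) (hc : MZ * A = A * MZ) (hu : IsUnit A.det)
    (hdet : (1 - A).det ≠ 0) : ∃ b c h m : ℤ, A = !![-1, b, c; 0, 2*b-1, 2*c; 0, h, 2*m+1] := by
  have e := fun i j => congrFun (congrFun hc i) j
  have e00 := e 0 0
  have e01 := e 0 1
  have e02 := e 0 2
  have e20 := e 2 0
  simp [MZ, Matrix.mul_apply, Fin.sum_univ_three] at e00 e01 e02 e20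
  have e20' : A 2 0 = 0 := by linarith
  rw [Matrix.det_fin_three, e00, e20'] at hu
  rw [Matrix.det_fin_three] at hdet
  simp [e00, e20'] at hdet
  have hA11 : A 1 1 = A 0 0 + 2 * A 0 1 := by linarith
  have hA12 : A 1 2 = 2 * A 0 2 := by linarith
  rw [hA11, hA12] at hu
  have hu' : IsUnit (A 0 0 * ((A 0 0 + 2 * A 0 1) * A 2 2 - 2 * A 0 2 * A 2 1)) := by
    convert hu using 1; ring
  have h2 := isUnit_of_mul_isUnit_left hu'
  have h3 := isUnit_of_mul_isUnit_right hu'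
  have ha : A 0 0 = -1 := by
    rcases Int.isUnit_iff.1 h2 with h | h
    · exfalso; apply hdet; rw [h]; ring
    · exact h
  have hk : Odd (A 2 2) := by
    have h4 : Odd ((A 0 0 + 2 * A 0 1) * A 2 2 - 2 * A 0 2 * A 2 1) := by
      rcases Int.isUnit_iff.1 h3 with h | h <;> rw [h] <;> decide
    by_contra hne
    rw [Int.not_odd_iff_even] at hne
    obtain ⟨n, hn⟩ := hne
    rw [← Int.not_even_iff_odd] at h4
    apply h4
    rw [hn]
    exact ⟨(A 0 0 + 2 * A 0 1) * n - A 0 2 * A 2 1, by ring⟩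
  obtain ⟨m, hm⟩ := hk
  refine ⟨A 0 1, A 0 2, A 2 1, m, ?_⟩
  ext i j
  fin_cases i <;> fin_cases j <;> simp [ha, e00, e20', hA12, hm]
  linarith

theorem one_sub_shape_mulVec (b c h m : ℤ) (w : Fin 3 → ℤ) :
    (1 - !![-1, b, c; 0, 2*b-1, 2*c; 0, h, 2*m+1] : Matrix (Fin 3) (Fin 3) ℤ) *ᵥ w =
    ![2 * w 0 - b * w 1 - c * w 2, (2 - 2 * b) * w 1 - 2 * c * w 2, - h * w 1 - 2 * m * w 2] := by
  ext i
  fin_cases i <;>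
    simp [Matrix.mulVec, dotProduct, Fin.sum_univ_three] <;> ring

theorem B_mulVec (b c h m : ℤ) (w : Fin 3 → ℤ) :
    (!![1, 0, 0; 0, 2 - 2 * b, -c; 0, -h, -m] : Matrix (Fin 3) (Fin 3) ℤ) *ᵥ w =
    ![w 0, (2 - 2 * b) * w 1 - c * w 2, - h * w 1 - m * w 2] := by
  ext i
  fin_cases i <;>
    simp [Matrix.mulVec, dotProduct, Fin.sum_univ_three] <;> ring

theorem mem_L (b c h m : ℤ) (v : Fin 3 → ℤ) :
    v ∈ rng !![1, 0, 0; 0, 2 - 2 * b, -c; 0, -h, -m] ↔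
    MZ *ᵥ v - v ∈ rng (1 - !![-1, b, c; 0, 2*b-1, 2*c; 0, h, 2*m+1]) := by
  rw [mem_rng, mem_rng]
  simp only [one_sub_shape_mulVec, B_mulVec, MZ_mulVec]
  constructor
  · rintro ⟨w, rfl⟩
    refine ⟨![-w 1, -2 * w 1, - w 2], ?_⟩
    ext i
    fin_cases i <;> simp <;> ring
  · rintro ⟨w, hw⟩
    have h0 := congrFun hw 0
    have h1 := congrFun hw 1
    have h2 := congrFun hw 2
    simp at h0 h1 h2
    have hq : w 1 = 2 * w 0 := by linarith
    rw [hq] at h0 h1 h2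
    refine ⟨![v 0, -w 0, - w 2], ?_⟩
    ext i
    fin_cases i <;> simp <;> linarith

theorem count_fix (A : Matrix (Fin 3) (Fin 3) ℤ) (hc : MZ * A = A * MZ) (hu : IsUnit A.det)
    (hdet : (1 - A).det ≠ 0) (t : Fin 3 → ℤ) (ht : t 1 = 2 * t 0) [Decidable (Even (t 2))] :
    ENat.card {q // sig A hc t q = q} = if Even (t 2) then 4 else 0 := by
  obtain ⟨b, c, h, m, rfl⟩ := exists_shape A hc hu hdet
  set A : Matrix (Fin 3) (Fin 3) ℤ := !![-1, b, c; 0, 2*b-1, 2*c; 0, h, 2*m+1] with hA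
  have hsub : ∀ v : Fin 3 → ℤ, sig A hc t (QuotientAddGroup.mk v) = QuotientAddGroup.mk v ↔
      MZ *ᵥ v + t - v ∈ rng (1 - A) := by
    intro v
    rw [sig_mk, QuotientAddGroup.eq_iff_sub_mem]
  split_ifs with hev
  · obtain ⟨u, hu2⟩ := hev
    set v0 : Fin 3 → ℤ := ![0, t 0, u]
    set L := rng !![1, 0, 0; 0, 2 - 2 * b, -c; 0, -h, -m] with hL
    have hdA : (1 - A).det = 4 * (!![1, 0, 0; 0, 2 - 2 * b, -c; 0, -h, -m] : Matrix (Fin 3) (Fin 3) ℤ).det := by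
      simp [hA, Matrix.det_fin_three]; ring
    have hdB : (!![1, 0, 0; 0, 2 - 2 * b, -c; 0, -h, -m] : Matrix (Fin 3) (Fin 3) ℤ).det ≠ 0 := by
      intro h0; rw [hdA, h0] at hdet; simp at hdet
    have hKL : rng (1 - A) ≤ L := by
      intro v hv
      rw [hL, mem_L]
      refine AddSubgroup.sub_mem _ ?_ hv
      rw [mem_rng] at hv ⊢
      obtain ⟨w, rfl⟩ := hv
      refine ⟨MZ *ᵥ w, ?_⟩
      simp only [Matrix.mulVec_mulVec]
      congr 1
      rw [sub_mul, mul_sub, hc, one_mul, mul_one]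
    have hrel : (rng (1 - A)).relIndex L = 4 := by
      have h1 := AddSubgroup.relIndex_mul_index hKL
      rw [index_rng _ hdet, hL, index_rng _ hdB, hdA, Int.natAbs_mul] at h1
      exact Nat.eq_of_mul_eq_mul_right (Int.natAbs_pos.2 hdB) h1
    have hcard : Nat.card (L.map (QuotientAddGroup.mk' (rng (1 - A)))) = 4 := by
      rw [← AddSubgroup.relIndex_ker, QuotientAddGroup.ker_mk', hrel]
    have hfix : ∀ q, sig A hc t q = q ↔
        q - QuotientAddGroup.mk v0 ∈ L.map (QuotientAddGroup.mk' (rng (1 - A))) := by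
      intro q
      induction q using QuotientAddGroup.induction_on with
      | H v =>
        rw [hsub, ← QuotientAddGroup.mk_sub]
        have e1 : MZ *ᵥ v + t - v = MZ *ᵥ (v - v0) - (v - v0) := by
          rw [MZ_mulVec, MZ_mulVec]
          ext i
          fin_cases i <;> simp [v0, Matrix.vecHead, Matrix.vecTail] <;> linarith
        rw [e1, ← mem_L, ← hL]
        constructor
        · intro hv
          exact ⟨v - v0, hv, rfl⟩
        · rintro ⟨x, hx, hxe⟩
          have h3 : x - (v - v0) ∈ rng (1 - A) := by
            rw [← QuotientAddGroup.eq_iff_sub_mem]; exact hxe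
          have := L.sub_mem hx (hKL h3)
          simpa using this
    have e : {q // sig A hc t q = q} ≃ L.map (QuotientAddGroup.mk' (rng (1 - A))) :=
      (Equiv.subRight (QuotientAddGroup.mk v0)).subtypeEquiv hfix
    rw [ENat.card_congr e]
    have : Finite (L.map (QuotientAddGroup.mk' (rng (1 - A)))) :=
      Nat.finite_of_card_ne_zero (by rw [hcard]; norm_num)
    rw [ENat.card_eq_coe_natCard, hcard]
    rfl
  · rw [ENat.card_eq_zero_iff_empty]
    constructor
    rintro ⟨q, hq⟩
    induction q using QuotientAddGroup.induction_on with
    | H v =>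
      rw [hsub, mem_rng] at hq
      obtain ⟨w, hw⟩ := hq
      rw [hA, one_sub_shape_mulVec, MZ_mulVec] at hw
      have h0 := congrFun hw 0
      have h1 := congrFun hw 1
      have h2 := congrFun hw 2
      simp [Matrix.vecHead, Matrix.vecTail] at h0 h1 h2
      have hq : w 1 = 2 * w 0 := by linarith
      apply hev
      rw [hq] at h2
      exact ⟨v 2 - h * w 0 - m * w 2, by linarith⟩

/-- Twisted conjugacy relation in coordinates. -/
def TRel (A : Matrix (Fin 3) (Fin 3) ℤ) (t z z' : Fin 3 → ℤ) : Prop :=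
  ∃ w, z + A *ᵥ w = w + z' ∨ z + A *ᵥ w = w + MZ *ᵥ z' + t

theorem count_TRel (A : Matrix (Fin 3) (Fin 3) ℤ) (hc : MZ * A = A * MZ) (hu : IsUnit A.det)
    (t : Fin 3 → ℤ) (ht : t 1 = 2 * t 0) [Decidable (Even (t 2))] :
    2 * ENat.card (Quot (TRel A t)) =
      intAbsInfty (1 - A).det + if Even (t 2) then 4 else 0 := by
  have hs := sig_sig A hc t ht
  have hR : ∀ z z', TRel A t z z' ↔
      ((z : (Fin 3 → ℤ) ⧸ rng (1 - A)) = z' ∨ (z : (Fin 3 → ℤ) ⧸ rng (1 - A)) = sig A hc t z') := by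
    intro z z'
    rw [sig_mk, QuotientAddGroup.eq_iff_sub_mem, QuotientAddGroup.eq_iff_sub_mem, mem_rng, mem_rng,
      ← exists_or]
    apply exists_congr
    intro w
    rw [Matrix.sub_mulVec, Matrix.one_mulVec]
    apply or_congr
    · constructor <;> intro h
      · rw [sub_eq_sub_iff_add_eq_add, ← h, add_comm]
      · rw [sub_eq_sub_iff_add_eq_add] at h; rw [h, add_comm]
    · constructor <;> intro h
      · rw [sub_eq_sub_iff_add_eq_add, ← add_assoc, ← h, add_comm]
      · rw [sub_eq_sub_iff_add_eq_add] at h; rw [add_assoc, h, add_comm]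
  set r : (Fin 3 → ℤ) ⧸ rng (1 - A) → (Fin 3 → ℤ) ⧸ rng (1 - A) → Prop :=
    fun a b => a = b ∨ a = sig A hc t b with hr
  have heq : Equivalence r := by
    refine ⟨fun a => Or.inl rfl, ?_, ?_⟩
    · rintro a b (h | h)
      · exact Or.inl h.symm
      · right; rw [h, hs]
    · rintro a b c (h | h) (h' | h')
      · left; rw [h, h']
      · right; rw [h, h']
      · right; rw [h, h']
      · left; rw [h, h', hs]
  let F : Quot (TRel A t) → Quot r := Quot.map (fun z => QuotientAddGroup.mk z)
    (fun z z' h => (hR z z').1 h)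
  have hF : Function.Bijective F := by
    constructor
    · rintro ⟨z⟩ ⟨z'⟩ h
      exact Quot.sound ((hR z z').2 ((heq.quot_mk_eq_iff _ _).1 h))
    · rintro ⟨q⟩
      induction q using QuotientAddGroup.induction_on with
      | H v => exact ⟨Quot.mk _ v, rfl⟩
  rw [ENat.card_congr (Equiv.ofBijective F hF), card_orbit_involution _ hs, card_rng]
  by_cases hdet : (1 - A).det = 0
  · simp [intAbsInfty, hdet]
  · rw [count_fix A hc hu hdet t ht]

/-- Integer vectors as real vectors. -/
def cv (z : Fin 3 → ℤ) : Fin 3 → ℝ := fun i => (z i : ℝ)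

theorem cv_inj {z z' : Fin 3 → ℤ} (h : cv z = cv z') : z = z' := by
  ext i
  have := congrFun h i
  simpa [cv] using this

theorem cv_add (z z' : Fin 3 → ℤ) : cv (z + z') = cv z + cv z' := by
  ext i; simp [cv]

theorem cv_neg (z : Fin 3 → ℤ) : cv (-z) = - cv z := by
  ext i; simp [cv]

theorem cv_zero : cv 0 = 0 := by
  ext i; simp [cv]

theorem cv_mulVec (A : Matrix (Fin 3) (Fin 3) ℤ) (z : Fin 3 → ℤ) :
    A.map (Int.cast : ℤ → ℝ) *ᵥ cv z = cv (A *ᵥ z) := by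
  ext i; simp [cv, Matrix.mulVec, dotProduct]

theorem Mmat_eq : Mmat = MZ.map (Int.cast : ℤ → ℝ) := by
  ext i j
  fin_cases i <;> fin_cases j <;> simp [Mmat, MZ]

theorem MGL_coe : (MGL : Matrix (Fin 3) (Fin 3) ℝ) = Mmat := rfl

theorem MGL_mul_self : MGL * MGL = 1 := Units.ext Mmat_mul_self

theorem MGL_inv : MGL⁻¹ = MGL := inv_eq_of_mul_eq_one_left MGL_mul_self

theorem MGL_ne_one : MGL ≠ 1 := by
  intro h
  have := congrArg (fun X : GL (Fin 3) ℝ => (X : Matrix (Fin 3) (Fin 3) ℝ) 1 1) h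
  simp [MGL_coe, Mmat] at this
  norm_num at this

/-- Explicit form of the group. -/
def GammaE : Subgroup (Aff 3) where
  carrier := {x | ∃ z : Fin 3 → ℤ, x = ⟨cv z, 1⟩ ∨ x = ⟨cv z, MGL⟩}
  one_mem' := ⟨0, Or.inl (by rw [cv_zero]; rfl)⟩
  mul_mem' := by
    rintro a b ⟨z, rfl | rfl⟩ ⟨z', rfl | rfl⟩
    · exact ⟨z + z', Or.inl (by simp [Aff.mul_def, cv_add])⟩
    · exact ⟨z + z', Or.inr (by simp [Aff.mul_def, cv_add])⟩
    · exact ⟨z + MZ *ᵥ z', Or.inr (by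
        simp [Aff.mul_def, cv_add, MGL_coe, Mmat_eq, cv_mulVec])⟩
    · exact ⟨z + MZ *ᵥ z', Or.inl (by
        simp [Aff.mul_def, cv_add, MGL_coe, Mmat_eq, cv_mulVec, MGL_mul_self])⟩
  inv_mem' := by
    rintro a ⟨z, rfl | rfl⟩
    · exact ⟨-z, Or.inl (by simp [Aff.inv_def, cv_neg])⟩
    · exact ⟨MZ *ᵥ (-z), Or.inr (by
        simp only [Aff.inv_def, MGL_inv, MGL_coe, Mmat_eq]
        rw [← cv_neg, cv_mulVec])⟩

theorem tr_mem (z : Fin 3 → ℤ) : (⟨cv z, 1⟩ : Aff 3) ∈ Gamma3 :=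
  Subgroup.subset_closure (Or.inl ⟨z, rfl⟩)

theorem M_mem (z : Fin 3 → ℤ) : (⟨cv z, MGL⟩ : Aff 3) ∈ Gamma3 := by
  have h1 : (⟨0, MGL⟩ : Aff 3) ∈ Gamma3 := Subgroup.subset_closure (Or.inr rfl)
  have := Gamma3.mul_mem (tr_mem z) h1
  simpa [Aff.mul_def] using this

theorem mem_Gamma3 (x : Aff 3) :
    x ∈ Gamma3 ↔ ∃ z : Fin 3 → ℤ, x = ⟨cv z, 1⟩ ∨ x = ⟨cv z, MGL⟩ := by
  constructor
  · intro hx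
    have : Gamma3 ≤ GammaE := by
      rw [Gamma3, Subgroup.closure_le]
      rintro y (⟨z, rfl⟩ | rfl)
      · exact ⟨z, Or.inl rfl⟩
      · exact ⟨0, Or.inr (by rw [cv_zero])⟩
    exact this hx
  · rintro ⟨z, rfl | rfl⟩
    · exact tr_mem z
    · exact M_mem z

theorem twistedConj_equivalence {G : Type*} [Group G] (φ : G →* G) :
    Equivalence (twistedConj φ) := by
  refine ⟨fun x => ⟨1, by simp⟩, ?_, ?_⟩
  · rintro x y ⟨h, rfl⟩
    exact ⟨h⁻¹, by simp [mul_assoc]⟩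
  · rintro x y z ⟨h, rfl⟩ ⟨k, rfl⟩
    exact ⟨h * k, by simp [mul_assoc]⟩

theorem twistedConj_xi (g : Aff 3) (hg : XiIsAut g Gamma3) (x y : Gamma3) :
    twistedConj (xi g Gamma3 hg) x y ↔
      ∃ h ∈ Gamma3, (x : Aff 3) * g * h = h * y * g := by
  constructor
  · rintro ⟨h, rfl⟩
    refine ⟨h, h.2, ?_⟩
    simp [xi, mul_assoc]
  · rintro ⟨h, hh, he⟩
    refine ⟨⟨h, hh⟩, ?_⟩
    apply Subtype.ext
    have : (x : Aff 3) = h * y * g * h⁻¹ * g⁻¹ := by rw [← he]; group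
    simp [xi, mul_assoc, this]

theorem isUnit_det (g : Aff 3) (hg : XiIsAut g Gamma3)
    (DZ : Matrix (Fin 3) (Fin 3) ℤ)
    (hDZ : (g.lin : Matrix (Fin 3) (Fin 3) ℝ) = DZ.map (Int.cast : ℤ → ℝ)) :
    IsUnit DZ.det := by
  have h1 : ∀ v : Fin 3 → ℤ, ∃ w : Fin 3 → ℤ, DZ *ᵥ w = v := by
    intro v
    have h2 : g⁻¹ * ⟨cv v, 1⟩ * g ∈ Gamma3 := by
      rw [hg]
      have : g * (g⁻¹ * ⟨cv v, 1⟩ * g) * g⁻¹ = ⟨cv v, 1⟩ := by group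
      rw [this]; exact tr_mem v
    rw [mem_Gamma3] at h2
    obtain ⟨w, hw | hw⟩ := h2
    · refine ⟨w, cv_inj ?_⟩
      have h3 : (⟨cv v, 1⟩ : Aff 3) * g = g * ⟨cv w, 1⟩ := by rw [← hw]; group
      have h4 := congrArg Aff.tr h3
      simp only [Aff.mul_def, Units.val_one, Matrix.one_mulVec, hDZ, cv_mulVec] at h4
      rw [add_comm] at h4
      exact (add_left_cancel h4).symm
    · exfalso
      have h3 : (⟨cv v, 1⟩ : Aff 3) * g = g * ⟨cv w, MGL⟩ := by rw [← hw]; group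
      have h4 := congrArg Aff.lin h3
      simp only [Aff.mul_def, one_mul] at h4
      exact MGL_ne_one (mul_left_cancel (a := g.lin) (by rw [← h4, mul_one]))
  choose f hf using h1
  set B : Matrix (Fin 3) (Fin 3) ℤ := Matrix.of fun i j => f (Pi.single j 1) i
  have hB : DZ * B = 1 := by
    ext i j
    have := congrFun (hf (Pi.single j 1)) i
    simp only [Matrix.mulVec, dotProduct] at this
    simp only [Matrix.mul_apply, B, Matrix.of_apply, this]
    simp [Matrix.one_apply, Pi.single_apply]
  have := congrArg Matrix.det hB
  rw [Matrix.det_mul, Matrix.det_one] at this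
  exact IsUnit.of_mul_eq_one _ this

theorem map_inj {A B : Matrix (Fin 3) (Fin 3) ℤ}
    (h : A.map (Int.cast : ℤ → ℝ) = B.map (Int.cast : ℤ → ℝ)) : A = B :=
  Matrix.map_injective Int.cast_injective h

theorem map_mul' (A B : Matrix (Fin 3) (Fin 3) ℤ) :
    (A * B).map (Int.cast : ℤ → ℝ) = A.map (Int.cast : ℤ → ℝ) * B.map (Int.cast : ℤ → ℝ) := by
  ext i j; simp [Matrix.mul_apply]

theorem commute_data (g : Aff 3) (hg : XiIsAut g Gamma3)
    (DZ : Matrix (Fin 3) (Fin 3) ℤ)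
    (hDZ : (g.lin : Matrix (Fin 3) (Fin 3) ℝ) = DZ.map (Int.cast : ℤ → ℝ)) :
    MZ * DZ = DZ * MZ ∧ MGL * g.lin = g.lin * MGL ∧
      ∃ t : Fin 3 → ℤ, Mmat *ᵥ g.tr = g.tr + cv t := by
  have h1 := (hg ⟨0, MGL⟩).1 (by have := M_mem 0; rwa [cv_zero] at this)
  rw [mem_Gamma3] at h1
  obtain ⟨z, hz | hz⟩ := h1
  · exfalso
    have h3 : (⟨cv z, 1⟩ : Aff 3) * g = g * ⟨0, MGL⟩ := by rw [← hz]; group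
    have h4 := congrArg Aff.lin h3
    simp only [Aff.mul_def, one_mul] at h4
    exact MGL_ne_one (mul_left_cancel (a := g.lin) (by rw [← h4, mul_one]))
  · have h3 : (⟨cv z, MGL⟩ : Aff 3) * g = g * ⟨0, MGL⟩ := by rw [← hz]; group
    have h4 := congrArg Aff.lin h3
    have h5 := congrArg Aff.tr h3
    simp only [Aff.mul_def] at h4 h5
    refine ⟨?_, h4, -z, ?_⟩
    · apply map_inj
      have := congrArg (fun X : GL (Fin 3) ℝ => (X : Matrix (Fin 3) (Fin 3) ℝ)) h4
      simp only [Units.val_mul, hDZ, MGL_coe, Mmat_eq] at this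
      rw [map_mul', map_mul', this]
    · rw [Matrix.mulVec_zero, add_zero, MGL_coe] at h5
      rw [cv_neg]; exact eq_add_neg_of_add_eq (by rw [add_comm]; exact h5)

theorem reid_eq (g : Aff 3) (hg : XiIsAut g Gamma3)
    (DZ : Matrix (Fin 3) (Fin 3) ℤ)
    (hDZ : (g.lin : Matrix (Fin 3) (Fin 3) ℝ) = DZ.map (Int.cast : ℤ → ℝ))
    (hc : MGL * g.lin = g.lin * MGL) (t : Fin 3 → ℤ) (ht : Mmat *ᵥ g.tr = g.tr + cv t) :
    reidemeisterNumber (xi g Gamma3 hg) =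
      ENat.card (Quot (TRel DZ t)) + ENat.card (Quot (TRel (MZ * DZ) (-t))) := by
  have key : ∀ x y : Aff 3, (∃ h ∈ Gamma3, x * g * h = h * y * g) ↔
      ∃ w : Fin 3 → ℤ, x * g * ⟨cv w, 1⟩ = ⟨cv w, 1⟩ * y * g ∨
        x * g * ⟨cv w, MGL⟩ = ⟨cv w, MGL⟩ * y * g := by
    intro x y
    constructor
    · rintro ⟨h, hh, he⟩
      obtain ⟨w, rfl | rfl⟩ := (mem_Gamma3 h).1 hh
      · exact ⟨w, Or.inl he⟩
      · exact ⟨w, Or.inr he⟩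
    · rintro ⟨w, h | h⟩
      · exact ⟨_, tr_mem w, h⟩
      · exact ⟨_, M_mem w, h⟩
  have cvi : ∀ a b : Fin 3 → ℤ, a = b ↔ cv a = cv b := fun a b => ⟨congrArg cv, cv_inj⟩
  have hMM : Mmat *ᵥ (Mmat *ᵥ g.tr) = g.tr := by
    rw [Matrix.mulVec_mulVec, Mmat_mul_self, Matrix.one_mulVec]
  have k11 : ∀ z z' : Fin 3 → ℤ, (∃ h ∈ Gamma3, (⟨cv z, 1⟩ : Aff 3) * g * h = h * ⟨cv z', 1⟩ * g) ↔
      TRel DZ t z z' := by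
    intro z z'
    rw [key]
    apply exists_congr
    intro w
    rw [cvi, cvi]
    simp only [Aff.mul_def, Aff.mk.injEq, one_mul, mul_one, Units.val_one, Matrix.one_mulVec,
      Units.val_mul, hDZ, MGL_coe, hc, and_true, cv_add, ← cv_mulVec, ← Mmat_eq, ht]
    apply or_congr
    · constructor <;> intro h <;> linear_combination (exp := 1) h
    · constructor <;> intro h <;> linear_combination (exp := 1) h
  have k22 : ∀ z z' : Fin 3 → ℤ,
      (∃ h ∈ Gamma3, (⟨cv z, MGL⟩ : Aff 3) * g * h = h * ⟨cv z', MGL⟩ * g) ↔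
      TRel (MZ * DZ) (-t) z z' := by
    intro z z'
    rw [key]
    apply exists_congr
    intro w
    rw [cvi, cvi]
    have hl : MGL * g.lin * MGL = MGL * MGL * g.lin := by rw [mul_assoc, ← hc, mul_assoc]
    simp only [Aff.mul_def, Aff.mk.injEq, one_mul, mul_one, Units.val_one, Matrix.one_mulVec,
      Units.val_mul, hDZ, MGL_coe, hl, and_true, cv_add, cv_neg, ← cv_mulVec, map_mul', ← Mmat_eq,
      ht, Mmat_mul_self]
    apply or_congr
    · constructor <;> intro h <;> linear_combination (exp := 1) h
    · constructor <;> intro h <;> linear_combination (exp := 1) h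
  have k12 : ∀ z z' : Fin 3 → ℤ,
      ¬ (∃ h ∈ Gamma3, (⟨cv z, 1⟩ : Aff 3) * g * h = h * ⟨cv z', MGL⟩ * g) := by
    intro z z'
    rw [key]
    rintro ⟨w, h | h⟩
    · have h4 := congrArg Aff.lin h
      simp only [Aff.mul_def, one_mul, mul_one] at h4
      exact MGL_ne_one (mul_right_cancel (b := g.lin) (by rw [← h4, one_mul]))
    · have h4 := congrArg Aff.lin h
      simp only [Aff.mul_def, one_mul, MGL_mul_self, ← hc] at h4
      exact MGL_ne_one (mul_right_cancel (b := g.lin) (by rw [h4, one_mul]))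
  have heq := twistedConj_equivalence (xi g Gamma3 hg)
  let F : Quot (TRel DZ t) ⊕ Quot (TRel (MZ * DZ) (-t)) → Quot (twistedConj (xi g Gamma3 hg)) :=
    Sum.elim
      (Quot.map (fun z => ⟨⟨cv z, 1⟩, tr_mem z⟩)
        (fun z z' h => (twistedConj_xi g hg _ _).2 ((k11 z z').2 h)))
      (Quot.map (fun z => ⟨⟨cv z, MGL⟩, M_mem z⟩)
        (fun z z' h => (twistedConj_xi g hg _ _).2 ((k22 z z').2 h)))
  have hF : Function.Bijective F := by
    constructor
    · rintro (z | z) (z' | z') h <;> induction z using Quot.ind with | _ z <;>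
        induction z' using Quot.ind with | _ z'
      · have h1 := (twistedConj_xi g hg _ _).1 ((heq.quot_mk_eq_iff _ _).1 h)
        exact congrArg Sum.inl (Quot.sound ((k11 z z').1 h1))
      · have h1 := (twistedConj_xi g hg _ _).1 ((heq.quot_mk_eq_iff _ _).1 h)
        exact absurd h1 (k12 z z')
      · have h1 := (twistedConj_xi g hg _ _).1 ((heq.quot_mk_eq_iff _ _).1 h.symm)
        exact absurd h1 (k12 z' z)
      · have h1 := (twistedConj_xi g hg _ _).1 ((heq.quot_mk_eq_iff _ _).1 h)
        exact congrArg Sum.inr (Quot.sound ((k22 z z').1 h1))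
    · rintro ⟨⟨x, hx⟩⟩
      obtain ⟨z, rfl | rfl⟩ := (mem_Gamma3 x).1 hx
      · exact ⟨Sum.inl (Quot.mk _ z), rfl⟩
      · exact ⟨Sum.inr (Quot.mk _ z), rfl⟩
  rw [reidemeisterNumber, ← ENat.card_congr (Equiv.ofBijective F hF), ENat.card_sum]

open Classical

/-- For the crystallographic group `Γ = 3/2/1/2/1` (holonomy `F = {I₃, M}`) and an
automorphism `ξ_{(d,D)}` of `Γ` (with `D` given by the integer matrix `DZ`), setting
`δ = 1` if `d₃ ∈ ℤ` and `δ = 0` otherwise: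
`R(ξ_{(d,D)}) = (|det(I₃ - D)|_∞ + |det(I₃ - M·D)|_∞)/2 + 4δ`, stated equivalently
after multiplying through by `2`. -/
theorem stmt17 (g : Aff 3) (hg : XiIsAut g Gamma3)
    (DZ : Matrix (Fin 3) (Fin 3) ℤ)
    (hDZ : (g.lin : Matrix (Fin 3) (Fin 3) ℝ) = DZ.map (Int.cast : ℤ → ℝ)) :
    2 * reidemeisterNumber (xi g Gamma3 hg) =
      intAbsInfty ((1 - DZ).det) + intAbsInfty ((1 - MZ * DZ).det) +
        8 * (if ∃ z : ℤ, g.tr 2 = (z : ℝ) then (1 : ℕ∞) else 0) := by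
  obtain ⟨hc, hcG, t, ht⟩ := commute_data g hg DZ hDZ
  have hu := isUnit_det g hg DZ hDZ
  have e := fun i => congrFun ht i
  have e0 := e 0
  have e1 := e 1
  have e2 := e 2
  simp [Mmat, Matrix.mulVec, dotProduct, Fin.sum_univ_three, cv] at e0 e1 e2
  have ht1 : t 1 = 2 * t 0 := by
    have : (t 1 : ℝ) = 2 * t 0 := by linarith
    exact_mod_cast this
  have hev : (∃ z : ℤ, g.tr 2 = (z : ℝ)) ↔ Even (t 2) := by
    constructor
    · rintro ⟨z, hz⟩
      refine ⟨-z, ?_⟩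
      have : (t 2 : ℝ) = -z + -z := by rw [← hz]; linarith
      exact_mod_cast this
    · rintro ⟨z, hz⟩
      refine ⟨-z, ?_⟩
      have : (t 2 : ℝ) = z + z := by exact_mod_cast hz
      push_cast
      linarith
  have hMdet : MZ.det = 1 := by simp [MZ, Matrix.det_fin_three]
  have hu2 : IsUnit (MZ * DZ).det := by rw [Matrix.det_mul, hMdet, one_mul]; exact hu
  have hc2 : MZ * (MZ * DZ) = (MZ * DZ) * MZ := by rw [mul_assoc, ← hc]
  have c1 := count_TRel DZ hc hu t ht1
  have c2 := count_TRel (MZ * DZ) hc2 hu2 (-t) (by simp [ht1])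
  rw [reid_eq g hg DZ hDZ hcG t ht, mul_add, c1, c2]
  simp only [Pi.neg_apply, even_neg, hev]
  split_ifs
  · rw [add_add_add_comm]; norm_num
  · simp
end
end
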